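/- arXiv:math/0508358 — 4 statements merged into one kernel-verified Lean document; each statement's English description precedes it below -/
import Mathlib

section
/- Let (R,m) be a Noetherian local ring of positive prime characteristic p. Every seed over R admits an R-algebra homomorphism to a balanced big Cohen-Macaulay R-algebra B that is reduced, perfect (the Frobenius endomorphism x ↦ x^p of B is bijective), quasilocal, and m-adically separated (∩_{k≥1} m^k B = 0). -/
open IsLocalRing

universe u v w

/-- `x` is a system of parameters of the local ring `R`: a sequence of `dim R` elements
of the maximal ideal generating an ideal primary to the maximal ideal. -/
def IsSOP (R : Type*) [CommRing R] [IsLocalRing R] {n : ℕ} (x : Fin n → R) : Prop :=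
  (n : WithBot ℕ∞) = ringKrullDim R ∧
  (∀ i, x i ∈ maximalIdeal R) ∧
  (Ideal.span (Set.range x)).radical = maximalIdeal R

/-- The sequence `x` of elements of `R` is a regular sequence on the `R`-module `M`. -/
def IsRegSeq (R : Type*) [CommRing R] (M : Type*) [AddCommGroup M] [Module R M]
    {n : ℕ} (x : Fin n → R) : Prop :=
  RingTheory.Sequence.IsRegular M (List.ofFn x)

/-- `B` is a big Cohen-Macaulay algebra over the local ring `R`: some system of
parameters of `R` is a regular sequence on `B` (and in particular `mB ≠ B`). -/
def IsBigCM (R : Type*) [CommRing R] [IsLocalRing R]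
    (B : Type*) [CommRing B] [Algebra R B] : Prop :=
  (∃ (n : ℕ) (x : Fin n → R), IsSOP R x ∧ IsRegSeq R B x) ∧
  (maximalIdeal R).map (algebraMap R B) ≠ ⊤

/-- `B` is a balanced big Cohen-Macaulay algebra over the local ring `R`: every system of
parameters of `R` is a regular sequence on `B` (and in particular `mB ≠ B`). -/
def IsBalancedBigCM (R : Type*) [CommRing R] [IsLocalRing R]
    (B : Type*) [CommRing B] [Algebra R B] : Prop :=
  (∀ (n : ℕ) (x : Fin n → R), IsSOP R x → IsRegSeq R B x) ∧
  (maximalIdeal R).map (algebraMap R B) ≠ ⊤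

/-- `S` is a seed over the local ring `R`: `S` admits an `R`-algebra homomorphism to some
big Cohen-Macaulay `R`-algebra. -/
def IsSeed (R : Type u) [CommRing R] [IsLocalRing R]
    (S : Type v) [CommRing S] [Algebra R S] : Prop :=
  ∃ (B : Type (max u v)) (_ : CommRing B) (_ : Algebra R B),
    IsBigCM R B ∧ Nonempty (S →ₐ[R] B)

open RingTheory.Sequence Ideal Submodule Function Pointwise in
/-- In a weakly regular sequence, each entry is regular modulo all the other entries that
precede it and follow it. -/
lemma isSMulRegular_quotient_of_isWeaklyRegular_cons {R : Type*} [CommRing R] {M : Type v}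
    [AddCommGroup M] [Module R M] {r : R} {ys : List R} (h : IsWeaklyRegular M (r :: ys)) :
    IsSMulRegular (M ⧸ (Ideal.ofList ys • ⊤ : Submodule R M)) r := by
  rw [isWeaklyRegular_cons_iff] at h
  obtain ⟨hr, hys⟩ := h
  have hex := map_first_exact_on_four_term_right_exact_of_isSMulRegular_last
    (f₁ := (0 : PUnit.{v+1} →ₗ[R] M)) (f₂ := LinearMap.lsmul R M r)
    (f₃ := (r • (⊤ : Submodule R M)).mkQ) (rs := ys) ?_ ?_ (mkQ_surjective _) hys
  · intro x y hxy
    rw [← sub_eq_zero] at hxy ⊢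
    replace hxy : r • (x - y) = 0 := by rw [smul_sub]; exact hxy
    obtain ⟨z, hz⟩ := Submodule.mkQ_surjective _ (x - y)
    rw [← hz] at hxy ⊢
    obtain ⟨t, ht⟩ := (hex (mkQ _ z)).mp hxy
    obtain ⟨t, rfl⟩ := Submodule.mkQ_surjective _ t
    rw [← ht]
    simp
  · intro y
    constructor
    · intro hy
      exact ⟨0, by
        have : r • y = r • (0 : M) := by rw [smul_zero]; exact hy
        exact (hr this).symm⟩
    · rintro ⟨x, rfl⟩
      simp
  · rw [LinearMap.exact_iff]
    ext y
    simp [Submodule.mem_smul_pointwise_iff_exists]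

open RingTheory.Sequence Ideal Submodule Function Pointwise in
/-- Weak regularity of a sequence passes from the outer terms of a short exact sequence to the
middle term. -/
lemma isWeaklyRegular_of_exact {R : Type*} [CommRing R] {ys : List R} :
    ∀ {M₁ M₂ M₃ : Type v} [AddCommGroup M₁] [AddCommGroup M₂] [AddCommGroup M₃]
      [Module R M₁] [Module R M₂] [Module R M₃] {f : M₁ →ₗ[R] M₂} {g : M₂ →ₗ[R] M₃},
      Injective f → Exact f g → Surjective g →
      IsWeaklyRegular M₁ ys → IsWeaklyRegular M₃ ys → IsWeaklyRegular M₂ ys := by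
  induction ys with
  | nil => intros; exact IsWeaklyRegular.nil _ _
  | cons r ys ih =>
    intro M₁ M₂ M₃ _ _ _ _ _ _ f g hf hfg hg h₁ h₃
    rw [isWeaklyRegular_cons_iff] at h₁ h₃ ⊢
    refine ⟨?_, ih (f := QuotSMulTop.map r f) (g := QuotSMulTop.map r g) ?_
      (QuotSMulTop.map_exact r hfg hg) (QuotSMulTop.map_surjective r hg) h₁.2 h₃.2⟩
    · intro x y hxy
      rw [← sub_eq_zero] at hxy ⊢
      replace hxy : r • (x - y) = 0 := by rw [smul_sub]; exact hxy
      have hgz : g (x - y) = 0 := h₃.1 (by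
        change r • _ = r • _
        rw [← map_smul, hxy, map_zero, smul_zero])
      obtain ⟨t, ht⟩ := (hfg _).mp hgz
      rw [← ht, ← map_smul] at hxy
      have : t = 0 := h₁.1 (by
        change r • _ = r • _
        rw [smul_zero]; exact hf (by rw [hxy, map_zero]))
      rw [← ht, this, map_zero]
    · rw [injective_iff_map_eq_zero]
      intro x hx
      obtain ⟨x, rfl⟩ := Submodule.mkQ_surjective _ x
      have hx' : f x ∈ r • (⊤ : Submodule R M₂) := by
        exact (Submodule.Quotient.mk_eq_zero _).mp hx
      obtain ⟨y, -, hy⟩ := (Submodule.mem_smul_pointwise_iff_exists _ _ _).mp hx'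
      have hgy : g y = 0 := h₃.1 (by
        change r • _ = r • _
        rw [← map_smul, hy, smul_zero, hfg.apply_apply_eq_zero])
      obtain ⟨t, rfl⟩ := (hfg _).mp hgy
      have : r • t = x := hf (by rw [map_smul, hy])
      simp only [mkQ_apply, Submodule.Quotient.mk_eq_zero]
      exact (Submodule.mem_smul_pointwise_iff_exists _ _ _).mpr ⟨t, trivial, this⟩

open RingTheory.Sequence Ideal Submodule Function Pointwise in
lemma isWeaklyRegular_quotSMulTop_mul {R : Type*} [CommRing R] {M : Type v}
    [AddCommGroup M] [Module R M] {a b : R} {ys : List R} (ha : IsSMulRegular M a)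
    (h₁ : IsWeaklyRegular (QuotSMulTop a M) ys) (h₂ : IsWeaklyRegular (QuotSMulTop b M) ys) :
    IsWeaklyRegular (QuotSMulTop (a * b) M) ys := by
  let f : QuotSMulTop b M →ₗ[R] QuotSMulTop (a * b) M :=
    mapQ _ _ (LinearMap.lsmul R M a) (by
      intro x hx
      obtain ⟨y, -, rfl⟩ := (Submodule.mem_smul_pointwise_iff_exists _ _ _).mp hx
      exact (Submodule.mem_smul_pointwise_iff_exists _ _ _).mpr
        ⟨y, trivial, by simp [mul_smul, smul_comm a b]⟩)
  let g : QuotSMulTop (a * b) M →ₗ[R] QuotSMulTop a M :=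
    mapQ _ _ LinearMap.id (by
      intro x hx
      obtain ⟨y, -, rfl⟩ := (Submodule.mem_smul_pointwise_iff_exists _ _ _).mp hx
      exact (Submodule.mem_smul_pointwise_iff_exists _ _ _).mpr
        ⟨b • y, trivial, by simp [mul_smul]⟩)
  refine isWeaklyRegular_of_exact (f := f) (g := g) ?_ ?_ ?_ h₂ h₁
  · rw [injective_iff_map_eq_zero]
    intro x hx
    obtain ⟨x, rfl⟩ := Submodule.mkQ_surjective _ x
    have hx' : a • x ∈ (a * b) • (⊤ : Submodule R M) := by
      exact (Submodule.Quotient.mk_eq_zero _).mp hx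
    obtain ⟨y, -, hy⟩ := (Submodule.mem_smul_pointwise_iff_exists _ _ _).mp hx'
    rw [mul_smul] at hy
    simp only [mkQ_apply, Submodule.Quotient.mk_eq_zero]
    exact (Submodule.mem_smul_pointwise_iff_exists _ _ _).mpr ⟨y, trivial, ha hy⟩
  · intro x
    obtain ⟨x, rfl⟩ := Submodule.mkQ_surjective _ x
    constructor
    · intro hx
      have hx' : x ∈ a • (⊤ : Submodule R M) := by
        simpa [g] using hx
      obtain ⟨y, -, hy⟩ := (Submodule.mem_smul_pointwise_iff_exists _ _ _).mp hx'
      exact ⟨mkQ _ y, by simp [f, ← hy]⟩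
    · rintro ⟨y, hy⟩
      obtain ⟨y, rfl⟩ := Submodule.mkQ_surjective _ y
      rw [← hy]
      simp only [f, g, mkQ_apply, mapQ_apply, LinearMap.lsmul_apply, LinearMap.id_apply,
        Submodule.Quotient.mk_eq_zero]
      exact (Submodule.mem_smul_pointwise_iff_exists _ _ _).mpr ⟨y, trivial, rfl⟩
  · intro x
    obtain ⟨x, rfl⟩ := Submodule.mkQ_surjective _ x
    exact ⟨mkQ _ x, by simp [g]⟩

open RingTheory.Sequence Ideal Submodule Function Pointwise in
/-- Replacing all entries of a weakly regular sequence by their `n`-th powers. -/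
lemma isWeaklyRegular_map_pow {R : Type*} [CommRing R] (n : ℕ) {ys : List R} :
    ∀ {M : Type v} [AddCommGroup M] [Module R M], IsWeaklyRegular M ys →
      IsWeaklyRegular M (ys.map (· ^ n)) := by
  induction ys with
  | nil => intros; exact IsWeaklyRegular.nil _ _
  | cons r ys ih =>
    intro M _ _ h
    rw [isWeaklyRegular_cons_iff] at h
    rw [List.map_cons, isWeaklyRegular_cons_iff]
    refine ⟨h.1.pow n, ?_⟩
    have h2 := ih h.2
    generalize ys.map (· ^ n) = zs at h2
    clear ih
    induction n with
    | zero =>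
      have : Subsingleton (QuotSMulTop (r ^ 0) M) := by
        rw [pow_zero, QuotSMulTop, one_smul]
        infer_instance
      exact ⟨fun i hi ↦ fun x y _ ↦ by
        obtain ⟨x, rfl⟩ := Submodule.mkQ_surjective _ x
        obtain ⟨y, rfl⟩ := Submodule.mkQ_surjective _ y
        rw [Subsingleton.elim x y]⟩
    | succ n ihn =>
      rw [pow_succ]
      exact isWeaklyRegular_quotSMulTop_mul (h.1.pow n) ihn h2

open RingTheory.Sequence Ideal in
lemma isSMulRegular_quotient_self_iff {C : Type*} [CommRing C] {J : Ideal C} {r : C} :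
    IsSMulRegular (C ⧸ (J • ⊤ : Submodule C C)) r ↔ ∀ c, r * c ∈ J → c ∈ J := by
  have hJ : (J • ⊤ : Submodule C C) = J := by simp
  constructor
  · intro h c hc
    have : (Submodule.Quotient.mk c : C ⧸ (J • ⊤ : Submodule C C)) = 0 := h (by
      change r • _ = r • _
      rw [smul_zero, ← Submodule.Quotient.mk_smul, Submodule.Quotient.mk_eq_zero, hJ]
      exact hc)
    rwa [Submodule.Quotient.mk_eq_zero, hJ] at this
  · intro h x y hxy
    rw [← sub_eq_zero] at hxy ⊢
    replace hxy : r • (x - y) = 0 := by rw [smul_sub]; exact hxy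
    obtain ⟨z, hz⟩ := Submodule.mkQ_surjective _ (x - y)
    rw [← hz] at hxy ⊢
    rw [Submodule.mkQ_apply, ← Submodule.Quotient.mk_smul, Submodule.Quotient.mk_eq_zero, hJ] at hxy
    rw [Submodule.mkQ_apply, Submodule.Quotient.mk_eq_zero, hJ]
    exact h z hxy

open RingTheory.Sequence Ideal in
/-- Elementwise criterion for weak regularity of a sequence on the ring itself. -/
lemma isWeaklyRegular_self_iff {C : Type*} [CommRing C] {rs : List C} :
    IsWeaklyRegular C rs ↔ ∀ i (h : i < rs.length), ∀ c,
      rs[i] * c ∈ Ideal.ofList (rs.take i) → c ∈ Ideal.ofList (rs.take i) := by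
  rw [isWeaklyRegular_iff]
  simp only [isSMulRegular_quotient_self_iff]

open RingTheory.Sequence Ideal Submodule in
lemma mem_of_mul_mem_of_isWeaklyRegular_append {C : Type*} [CommRing C] {ws ys : List C} {r : C}
    (h : IsWeaklyRegular C (ws ++ r :: ys)) (n : ℕ) {c : C}
    (hc : r * c ∈ Ideal.ofList ws ⊔ Ideal.ofList (ys.map (· ^ n))) :
    c ∈ Ideal.ofList ws ⊔ Ideal.ofList (ys.map (· ^ n)) := by
  rw [isWeaklyRegular_append_iff, isWeaklyRegular_cons_iff] at h
  have h2 := isSMulRegular_quotient_of_isWeaklyRegular_cons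
    (IsWeaklyRegular.cons h.2.1 (isWeaklyRegular_map_pow n h.2.2))
  set K := Ideal.ofList ws
  set Y := Ideal.ofList (ys.map (· ^ n))
  have hmem : ∀ z : C, ((K • ⊤ : Submodule C C).mkQ z ∈
      (Y • ⊤ : Submodule C (C ⧸ (K • ⊤ : Submodule C C)))) ↔ z ∈ K ⊔ Y := by
    intro z
    have h3 : (Y • ⊤ : Submodule C (C ⧸ (K • ⊤ : Submodule C C))) =
        (Y • ⊤ : Submodule C C).map (K • ⊤ : Submodule C C).mkQ := by
      rw [map_smul'', Submodule.map_top, range_mkQ]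
    rw [h3, ← Submodule.mem_comap, comap_map_mkQ]
    simp
  rw [← hmem] at hc ⊢
  rw [← Submodule.Quotient.mk_eq_zero]
  apply h2
  change r • _ = r • _
  rw [smul_zero, ← Submodule.Quotient.mk_smul, Submodule.Quotient.mk_eq_zero]
  exact hc

lemma exists_monotone_of_forall_exists {P : ℕ → ℕ → Prop}
    (hP : ∀ n k l, k ≤ l → P n k → P n l) (h : ∀ n, ∃ k, P n k) :
    ∃ g : ℕ → ℕ, Monotone g ∧ ∀ n, P n (g n) := by
  choose k hk using h
  refine ⟨fun n ↦ ∑ i ∈ Finset.range (n + 1), k i, ?_, fun n ↦ hP n _ _ ?_ (hk n)⟩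
  · intro a b hab
    exact Finset.sum_le_sum_of_subset (Finset.range_mono (by omega))
  · exact Finset.single_le_sum (f := k) (fun _ _ ↦ Nat.zero_le _) (by simp)

section Complete

variable {C : Type*} [CommRing C] {I : Ideal C}

lemma eq_zero_of_forall_mem_pow [IsAdicComplete I C] {c : C} (h : ∀ n, c ∈ I ^ n) : c = 0 := by
  refine IsHausdorff.haus (I := I) inferInstance c fun n ↦ ?_
  rw [SModEq.zero]
  simpa using h n

lemma exists_limit_of_sub_mem_pow [IsAdicComplete I C] {f : ℕ → C}
    (h : ∀ n, f (n + 1) - f n ∈ I ^ n) : ∃ L, ∀ n, L - f n ∈ I ^ n := by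
  have key : ∀ m k, f (m + k) - f m ∈ I ^ m := by
    intro m k
    induction k with
    | zero => simp
    | succ k ih =>
      have := add_mem (Ideal.pow_le_pow_right (Nat.le_add_right m k) (h (m + k))) ih
      rwa [sub_add_sub_cancel] at this
  obtain ⟨L, hL⟩ := IsPrecomplete.prec (I := I) inferInstance (f := f) (by
    intro m n hmn
    obtain ⟨k, rfl⟩ := Nat.exists_eq_add_of_le hmn
    refine SModEq.symm ?_
    rw [SModEq.sub_mem]
    simpa using key m k)
  refine ⟨L, fun n ↦ ?_⟩
  have := (hL n).symm
  rw [SModEq.sub_mem] at this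
  simpa using this

/-- If multiplication by `r` modulo a closed ideal `A` reflects the `I`-adic topology, then
`A + (r)` is closed. -/
lemma sup_span_singleton_closed [IsAdicComplete I C] {A : Ideal C} {r : C}
    (hA : ∀ c, (∀ n, c ∈ A ⊔ I ^ n) → c ∈ A)
    (hr : ∀ n, ∃ k, ∀ c, r * c ∈ A ⊔ I ^ k → c ∈ A ⊔ I ^ n)
    {c : C} (hc : ∀ n, c ∈ A ⊔ Ideal.span {r} ⊔ I ^ n) : c ∈ A ⊔ Ideal.span {r} := by
  obtain ⟨g, hg, hgr⟩ := exists_monotone_of_forall_exists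
    (P := fun n k ↦ n ≤ k ∧ ∀ c, r * c ∈ A ⊔ I ^ k → c ∈ A ⊔ I ^ n)
    (fun n k l hkl h ↦ ⟨h.1.trans hkl, fun c hc ↦ h.2 c
      (sup_le_sup_left (Ideal.pow_le_pow_right hkl) A hc)⟩)
    (fun n ↦ by
      obtain ⟨k, hk⟩ := hr n
      exact ⟨max n k, le_max_left _ _, fun c hc ↦ hk c
        (sup_le_sup_left (Ideal.pow_le_pow_right (le_max_right _ _)) A hc)⟩)
  have hdec : ∀ n, ∃ a, c - r * a ∈ A ⊔ I ^ g n := by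
    intro n
    have := hc (g n)
    rw [sup_right_comm, sup_comm, Ideal.mem_span_singleton_sup] at this
    obtain ⟨a, b, hb, rfl⟩ := this
    exact ⟨a, by convert hb using 1; ring⟩
  choose a ha using hdec
  have hdiff : ∀ n, a (n + 1) - a n ∈ A ⊔ I ^ n := by
    intro n
    refine (hgr n).2 _ ?_
    have h1 := sup_le_sup_left (Ideal.pow_le_pow_right (hg n.le_succ)) A (ha (n + 1))
    convert sub_mem (ha n) h1 using 1
    ring
  have hdiff' : ∀ n, ∃ t ∈ I ^ n, a (n + 1) - a n - t ∈ A := by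
    intro n
    obtain ⟨s, hs, t, ht, hst⟩ := Submodule.mem_sup.mp (hdiff n)
    exact ⟨t, ht, by rw [← hst]; simpa using hs⟩
  choose t ht hat using hdiff'
  let b : ℕ → C := fun n ↦ a 0 + ∑ i ∈ Finset.range n, t i
  have hb : ∀ n, a n - b n ∈ A := by
    intro n
    induction n with
    | zero => simp [b]
    | succ n ih =>
      convert add_mem (hat n) ih using 1
      simp only [b, Finset.sum_range_succ]
      ring
  obtain ⟨L, hL⟩ := exists_limit_of_sub_mem_pow (I := I) (f := b) (fun n ↦ by
    simpa [b, Finset.sum_range_succ] using ht n)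
  have hfin : c - r * L ∈ A := by
    refine hA _ fun n ↦ ?_
    have h1 : c - r * a n ∈ A ⊔ I ^ n :=
      sup_le_sup_left (Ideal.pow_le_pow_right (hgr n).1) A (ha n)
    have h2 : r * (a n - b n) ∈ A ⊔ I ^ n :=
      Ideal.mem_sup_left (Ideal.mul_mem_left _ _ (hb n))
    have h3 : r * (L - b n) ∈ A ⊔ I ^ n :=
      Ideal.mem_sup_right (Ideal.mul_mem_left _ _ (hL n))
    convert sub_mem (add_mem h1 h2) h3 using 1
    ring
  rw [sup_comm, Ideal.mem_span_singleton_sup]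
  exact ⟨L, _, hfin, by ring⟩

open RingTheory.Sequence in
/-- In a complete ring, a sequence that is regular up to the adic topology is weakly regular. -/
lemma isWeaklyRegular_of_isAdicComplete [IsAdicComplete I C] {rs : List C}
    (hr : ∀ i (h : i < rs.length), ∀ n, ∃ k, ∀ c,
      rs[i] * c ∈ Ideal.ofList (rs.take i) ⊔ I ^ k → c ∈ Ideal.ofList (rs.take i) ⊔ I ^ n) :
    IsWeaklyRegular C rs := by
  have closed : ∀ i, i ≤ rs.length → ∀ c,
      (∀ n, c ∈ Ideal.ofList (rs.take i) ⊔ I ^ n) → c ∈ Ideal.ofList (rs.take i) := by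
    intro i
    induction i with
    | zero =>
      intro _ c hc
      simp only [List.take_zero, Ideal.ofList_nil, bot_sup_eq, Ideal.mem_bot] at hc ⊢
      exact eq_zero_of_forall_mem_pow hc
    | succ i ih =>
      intro hi c hc
      have h1 : Ideal.ofList (rs.take (i + 1)) =
          Ideal.ofList (rs.take i) ⊔ Ideal.span {rs[i]} := by
        rw [List.take_succ_eq_append_getElem (by omega), Ideal.ofList_append,
          Ideal.ofList_singleton]
      rw [h1] at hc ⊢
      exact sup_span_singleton_closed (ih (by omega)) (hr i (by omega)) hc
  rw [isWeaklyRegular_self_iff]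
  intro i hi c hc
  refine closed i hi.le c fun n ↦ ?_
  obtain ⟨k, hk⟩ := hr i hi n
  exact hk c (Ideal.mem_sup_left hc)

lemma exists_telescoping [IsAdicComplete I C] {a : C} (ha : a ∈ I) (c : ℕ → C) :
    ∃ e : ℕ → C, ∀ n, e n = c n + a * e (n + 1) := by
  have h : ∀ n, ∃ L, ∀ k, L - ∑ i ∈ Finset.range k, a ^ i * c (n + i) ∈ I ^ k := fun n ↦
    exists_limit_of_sub_mem_pow (fun k ↦ by
      rw [Finset.sum_range_succ, add_sub_cancel_left]
      exact Ideal.mul_mem_right _ _ (Ideal.pow_mem_pow ha k))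
  choose e he using h
  refine ⟨e, fun n ↦ ?_⟩
  rw [← sub_eq_zero]
  refine eq_zero_of_forall_mem_pow (I := I) fun k ↦ ?_
  have h1 := Ideal.pow_le_pow_right k.le_succ (he n (k + 1))
  have h2 := Ideal.mul_mem_left _ a (he (n + 1) k)
  convert sub_mem h1 h2 using 1
  rw [Finset.sum_range_succ', mul_sub, Finset.mul_sum]
  have : ∀ i, a ^ (i + 1) * c (n + (i + 1)) = a * (a ^ i * c (n + 1 + i)) := by
    intro i
    rw [show n + (i + 1) = n + 1 + i by ring]
    ring
  simp only [this, pow_zero, one_mul, add_zero]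
  ring

/-- A form of Nakayama's lemma for quotients of complete rings by finitely generated ideals. -/
lemma mem_of_forall_sub_mul_mem [IsAdicComplete I C] {a : C} (ha : a ∈ I) {J : Ideal C}
    (hJ : J.FG) {b : ℕ → C} (hb : ∀ n, b n - a * b (n + 1) ∈ J) : b 0 ∈ J := by
  obtain ⟨N, v, rfl⟩ := Submodule.fg_iff_exists_fin_generating_family.mp hJ
  have h1 : ∀ n, ∃ c : Fin N → C, ∑ i, c i * v i = b n - a * b (n + 1) := fun n ↦
    Ideal.mem_span_range_iff_exists_fun.mp (hb n)
  choose c hc using h1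
  choose e he using fun i ↦ exists_telescoping ha (fun n ↦ c n i)
  let d : ℕ → C := fun n ↦ b n - ∑ i, e i n * v i
  have hd : ∀ n, d n = a * d (n + 1) := by
    intro n
    have h2 : ∑ i, e i n * v i = ∑ i, c n i * v i + a * ∑ i, e i (n + 1) * v i := by
      rw [Finset.mul_sum, ← Finset.sum_add_distrib]
      refine Finset.sum_congr rfl fun i _ ↦ ?_
      rw [he i n]
      ring
    simp only [d]
    rw [h2, hc n]
    ring
  have hd' : ∀ n, d 0 = a ^ n * d n := by
    intro n
    induction n with
    | zero => simp
    | succ n ih => rw [ih, hd n]; ring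
  have hd0 : d 0 = 0 := eq_zero_of_forall_mem_pow (I := I) fun n ↦ by
    rw [hd' n]
    exact Ideal.mul_mem_right _ _ (Ideal.pow_mem_pow ha n)
  rw [sub_eq_zero.mp hd0]
  exact Ideal.mem_span_range_iff_exists_fun.mpr ⟨fun i ↦ e i 0, rfl⟩

open RingTheory.Sequence Pointwise in
lemma isWeaklyRegular_perm_of_isAdicComplete [IsAdicComplete I C] {rs rs' : List C}
    (h : IsWeaklyRegular C rs) (hp : rs.Perm rs') (hI : ∀ r ∈ rs, r ∈ I) :
    IsWeaklyRegular C rs' := by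
  refine h.prototype_perm hp fun a b ws hsub ↦ ?_
  intro K hK
  have ha : a ∈ I := hI a (hsub.subset (by simp))
  have hJ : (Ideal.ofList ws).FG := Submodule.fg_span (List.finite_toSet ws)
  rw [eq_bot_iff]
  intro x hx
  have hstep : ∀ y : K, ∃ z : K, a • (z : C ⧸ (Ideal.ofList ws • ⊤ : Submodule C C)) = y := by
    intro y
    have hy := hK.le y.2
    obtain ⟨z, hz, hzy⟩ := (Submodule.mem_smul_pointwise_iff_exists _ _ _).mp hy
    exact ⟨⟨z, hz⟩, hzy⟩
  choose f hf using hstep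
  let s : ℕ → K := fun n ↦ f^[n] ⟨x, hx⟩
  choose q hq using Submodule.mkQ_surjective (Ideal.ofList ws • ⊤ : Submodule C C)
  have := mem_of_forall_sub_mul_mem ha hJ (b := fun n ↦ q (s n)) (by
    intro n
    have h1 : (Ideal.ofList ws • ⊤ : Submodule C C).mkQ (q (s n) - a • q (s (n + 1))) = 0 := by
      rw [map_sub, map_smul, hq, hq]
      simp only [s, Function.iterate_succ_apply', hf, sub_self]
    rw [Submodule.mkQ_apply, Submodule.Quotient.mk_eq_zero] at h1
    simpa using h1)
  have h2 : (Ideal.ofList ws • ⊤ : Submodule C C).mkQ (q (s 0)) = 0 := by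
    rw [Submodule.mkQ_apply, Submodule.Quotient.mk_eq_zero]
    simpa using this
  rw [hq] at h2
  simpa [s] using h2

end Complete

section Completion

variable {P C : Type*} [CommRing P] [CommRing C] [Algebra P C] {I : Ideal P}

/-- If `P / Iⁿ → C / IⁿC` is bijective for all `n`, then the contraction to `P` of the closure of
the extension of an ideal `K` of `P` is the closure of `K`. -/
lemma mem_sup_pow_of_algebraMap_mem
    (hs : ∀ n, ∀ c : C, ∃ b, c - algebraMap P C b ∈ I.map (algebraMap P C) ^ n)
    (hi : ∀ n b, algebraMap P C b ∈ I.map (algebraMap P C) ^ n → b ∈ I ^ n)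
    {K : Ideal P} {n : ℕ} {b : P}
    (hb : algebraMap P C b ∈ K.map (algebraMap P C) ⊔ I.map (algebraMap P C) ^ n) :
    b ∈ K ⊔ I ^ n := by
  have key : ∀ y ∈ K.map (algebraMap P C),
      ∃ t ∈ K, y - algebraMap P C t ∈ I.map (algebraMap P C) ^ n := by
    intro y hy
    induction hy using Submodule.span_induction with
    | mem x h =>
      obtain ⟨t, ht, rfl⟩ := h
      exact ⟨t, ht, by simp⟩
    | zero => exact ⟨0, zero_mem _, by simp⟩
    | add x y _ _ hx hy =>
      obtain ⟨s, hs, hsx⟩ := hx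
      obtain ⟨t, ht, hty⟩ := hy
      refine ⟨s + t, add_mem hs ht, ?_⟩
      convert add_mem hsx hty using 1
      rw [map_add]
      ring
    | smul a x _ hx =>
      obtain ⟨t, ht, htx⟩ := hx
      obtain ⟨a', ha'⟩ := hs n a
      refine ⟨a' * t, Ideal.mul_mem_left _ _ ht, ?_⟩
      convert add_mem (Ideal.mul_mem_left _ a htx)
        (Ideal.mul_mem_right (algebraMap P C t) _ ha') using 1
      rw [map_mul, smul_eq_mul]
      ring
  obtain ⟨y, hy, z, hz, hyz⟩ := Submodule.mem_sup.mp hb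
  obtain ⟨t, ht, hty⟩ := key y hy
  have h1 : b - t ∈ I ^ n := hi n _ (by
    rw [map_sub, ← hyz]
    convert add_mem hty hz using 1
    ring)
  exact Submodule.mem_sup.mpr ⟨t, ht, b - t, h1, by ring⟩

open RingTheory.Sequence in
/-- Multiplication by an entry of a weakly regular sequence reflects the adic topology on the
quotient by the previous entries. -/
lemma exists_forall_mem_sup_pow_of_isWeaklyRegular {ws ys : List P} {r : P}
    (h : IsWeaklyRegular P (ws ++ r :: ys)) (hI : I.FG) (hmem : ∀ x ∈ ws ++ r :: ys, x ∈ I)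
    (hrad : I ≤ (Ideal.ofList (ws ++ r :: ys)).radical) (n : ℕ) :
    ∃ k, ∀ c, r * c ∈ Ideal.ofList ws ⊔ I ^ k → c ∈ Ideal.ofList ws ⊔ I ^ n := by
  set Y := Ideal.ofList (ys.map (· ^ (n + 1))) with hY
  have hYI : Y ≤ I ^ n := by
    rw [hY, Ideal.span_le]
    intro x hx
    obtain ⟨y, hy, rfl⟩ := List.mem_map.mp hx
    exact Ideal.pow_le_pow_right n.le_succ
      (Ideal.pow_mem_pow (hmem y (by simp [hy])) (n + 1))
  have hle : I ≤ (Ideal.ofList ws ⊔ Y ⊔ Ideal.span {r ^ (n + 1)}).radical := by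
    refine hrad.trans ?_
    rw [Ideal.radical_le_radical_iff, Ideal.span_le]
    intro x hx
    rcases List.mem_append.mp hx with hx | hx
    · exact Ideal.le_radical (Ideal.mem_sup_left (Ideal.mem_sup_left (Ideal.subset_span hx)))
    · rcases List.mem_cons.mp hx with rfl | hx
      · exact ⟨n + 1, Ideal.mem_sup_right (Ideal.mem_span_singleton_self _)⟩
      · exact ⟨n + 1, Ideal.mem_sup_left (Ideal.mem_sup_right
          (Ideal.subset_span (List.mem_map.mpr ⟨x, hx, rfl⟩)))⟩
  obtain ⟨k, hk⟩ := Ideal.exists_pow_le_of_le_radical_of_fg hle hI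
  refine ⟨k, fun c hc ↦ ?_⟩
  have h1 : r * c ∈ Ideal.span {r ^ (n + 1)} ⊔ (Ideal.ofList ws ⊔ Y) := by
    rw [sup_comm]
    exact sup_le (le_sup_left.trans le_sup_left) hk hc
  rw [Ideal.mem_span_singleton_sup] at h1
  obtain ⟨t, z, hz, htz⟩ := h1
  have h2 : c - t * r ^ n ∈ Ideal.ofList ws ⊔ Y := by
    refine mem_of_mul_mem_of_isWeaklyRegular_append h (n + 1) ?_
    convert hz using 1
    rw [mul_sub, ← htz]
    ring
  have h3 : t * r ^ n ∈ Ideal.ofList ws ⊔ I ^ n :=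
    Ideal.mem_sup_right (Ideal.mul_mem_left _ _ (Ideal.pow_mem_pow (hmem r (by simp)) n))
  simpa using add_mem (sup_le_sup_left hYI _ h2) h3

open RingTheory.Sequence in
/-- Weakly regular sequences generating the topology stay weakly regular in the completion. -/
lemma isWeaklyRegular_map_of_completion [IsAdicComplete (I.map (algebraMap P C)) C]
    (hs : ∀ n, ∀ c : C, ∃ b, c - algebraMap P C b ∈ I.map (algebraMap P C) ^ n)
    (hi : ∀ n b, algebraMap P C b ∈ I.map (algebraMap P C) ^ n → b ∈ I ^ n)
    {rs : List P} (h : IsWeaklyRegular P rs) (hI : I.FG) (hmem : ∀ x ∈ rs, x ∈ I)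
    (hrad : I ≤ (Ideal.ofList rs).radical) :
    IsWeaklyRegular C (rs.map (algebraMap P C)) := by
  refine isWeaklyRegular_of_isAdicComplete (I := I.map (algebraMap P C)) fun i hlen n ↦ ?_
  rw [List.length_map] at hlen
  have hsplit : rs = rs.take i ++ rs[i] :: rs.drop (i + 1) := by simp
  obtain ⟨k, hk⟩ := exists_forall_mem_sup_pow_of_isWeaklyRegular (ws := rs.take i) (r := rs[i])
    (ys := rs.drop (i + 1)) (I := I) (by rwa [← hsplit]) hI (by rwa [← hsplit])
    (by rwa [← hsplit]) n
  refine ⟨max k n, fun c hc ↦ ?_⟩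
  rw [← List.map_take, ← Ideal.map_ofList] at hc ⊢
  rw [List.getElem_map] at hc
  obtain ⟨b, hb⟩ := hs (max k n) c
  have h1 : algebraMap P C (rs[i] * b) ∈ (Ideal.ofList (rs.take i)).map (algebraMap P C) ⊔
      I.map (algebraMap P C) ^ (max k n) := by
    convert sub_mem hc (Ideal.mem_sup_right (Ideal.mul_mem_left _ (algebraMap P C rs[i]) hb))
      using 1
    rw [map_mul]
    ring
  have hle : Ideal.ofList (rs.take i) ⊔ I ^ max k n ≤ Ideal.ofList (rs.take i) ⊔ I ^ k :=
    sup_le_sup_left (Ideal.pow_le_pow_right (le_max_left _ _)) _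
  have h2 := hk b (hle (mem_sup_pow_of_algebraMap_mem hs hi h1))
  have h3 : algebraMap P C b ∈ (Ideal.ofList (rs.take i)).map (algebraMap P C) ⊔
      I.map (algebraMap P C) ^ n := by
    have := Ideal.mem_map_of_mem (algebraMap P C) h2
    rwa [Ideal.map_sup, Ideal.map_pow] at this
  have h4 : c - algebraMap P C b ∈ (Ideal.ofList (rs.take i)).map (algebraMap P C) ⊔
      I.map (algebraMap P C) ^ n :=
    Ideal.mem_sup_right (Ideal.pow_le_pow_right (le_max_right _ _) hb)
  simpa using add_mem h4 h3

lemma exists_forall_mem_pow_of_pow_mem_pow (p : ℕ) [Fact p.Prime] [CharP P p] [PerfectRing P p]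
    (hI : I.FG) (n : ℕ) : ∃ k, ∀ b : P, b ^ p ∈ I ^ k → b ∈ I ^ n := by
  have hle : I ≤ ((I ^ n).map (frobenius P p)).radical := by
    intro x hx
    refine ⟨n * p, ?_⟩
    rw [pow_mul]
    exact Ideal.mem_map_of_mem (frobenius P p) (Ideal.pow_mem_pow hx n)
  obtain ⟨k, hk⟩ := Ideal.exists_pow_le_of_le_radical_of_fg hle hI
  refine ⟨k, fun b hb ↦ ?_⟩
  obtain ⟨y, hy, hyb⟩ := (Ideal.mem_map_iff_of_surjective _ (surjective_frobenius P p)).mp (hk hb)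
  rwa [← injective_frobenius P p hyb]

/-- The completion of a perfect ring with respect to a finitely generated ideal is perfect. -/
lemma bijective_frobenius_of_completion (p : ℕ) [Fact p.Prime] [CharP P p] [CharP C p]
    [PerfectRing P p] [IsAdicComplete (I.map (algebraMap P C)) C]
    (hs : ∀ n, ∀ c : C, ∃ b, c - algebraMap P C b ∈ I.map (algebraMap P C) ^ n)
    (hi : ∀ n b, algebraMap P C b ∈ I.map (algebraMap P C) ^ n → b ∈ I ^ n)
    (hI : I.FG) : Function.Bijective (frobenius C p) := by
  set J := I.map (algebraMap P C) with hJ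
  have hp : p ≠ 0 := (Fact.out : p.Prime).ne_zero
  have hmapJ : ∀ n b, b ∈ I ^ n → algebraMap P C b ∈ J ^ n := fun n b hb ↦ by
    rw [hJ, ← Ideal.map_pow]
    exact Ideal.mem_map_of_mem _ hb
  have hpowJ : ∀ n, ∀ c ∈ J ^ n, c ^ p ∈ J ^ n := fun n c hc ↦
    Ideal.pow_mem_of_mem _ hc p hp.bot_lt
  obtain ⟨g, hg, hgr⟩ := exists_monotone_of_forall_exists
    (P := fun n k ↦ n ≤ k ∧ ∀ b : P, b ^ p ∈ I ^ k → b ∈ I ^ n)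
    (fun n k l hkl h ↦ ⟨h.1.trans hkl, fun b hb ↦ h.2 b (Ideal.pow_le_pow_right hkl hb)⟩)
    (fun n ↦ by
      obtain ⟨k, hk⟩ := exists_forall_mem_pow_of_pow_mem_pow (I := I) p hI n
      exact ⟨max n k, le_max_left _ _, fun b hb ↦
        hk b (Ideal.pow_le_pow_right (le_max_right _ _) hb)⟩)
  constructor
  · rw [injective_iff_map_eq_zero]
    intro c hc
    refine eq_zero_of_forall_mem_pow (I := J) fun n ↦ ?_
    obtain ⟨b, hb⟩ := hs (g n) c
    have h1 : algebraMap P C (b ^ p) ∈ J ^ g n := by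
      have := hpowJ _ _ hb
      rw [sub_pow_char] at this
      change c ^ p = 0 at hc
      rw [hc, zero_sub, neg_mem_iff] at this
      rwa [map_pow]
    have h2 := hmapJ n b ((hgr n).2 b (hi _ _ h1))
    simpa using add_mem (Ideal.pow_le_pow_right (hgr n).1 hb) h2
  · intro c
    choose b hb using fun n ↦ hs (g n) c
    choose d hd using fun n ↦ surjective_frobenius P p (b n)
    simp only [frobenius_def] at hd
    have hdiff : ∀ n, d (n + 1) - d n ∈ I ^ n := by
      intro n
      refine (hgr n).2 _ (hi _ _ ?_)
      rw [sub_pow_char, hd, hd, map_sub]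
      convert sub_mem (hb n) (Ideal.pow_le_pow_right (hg n.le_succ) (hb (n + 1))) using 1
      ring
    obtain ⟨L, hL⟩ := exists_limit_of_sub_mem_pow (I := J) (f := fun n ↦ algebraMap P C (d n))
      (fun n ↦ by rw [← map_sub]; exact hmapJ n _ (hdiff n))
    refine ⟨L, ?_⟩
    rw [frobenius_def, ← sub_eq_zero]
    refine eq_zero_of_forall_mem_pow (I := J) fun n ↦ ?_
    have h1 := hpowJ _ _ (hL n)
    rw [sub_pow_char, ← map_pow, hd] at h1
    convert sub_mem h1 (Ideal.pow_le_pow_right (hgr n).1 (hb n)) using 1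
    ring

end Completion

section AdicCompletion

variable {P : Type*} [CommRing P] (I : Ideal P)

lemma AdicCompletion.mem_map_pow_iff (hI : I.FG) (n : ℕ) (c : AdicCompletion I P) :
    c ∈ I.map (algebraMap P (AdicCompletion I P)) ^ n ↔ AdicCompletion.eval I P n c = 0 := by
  rw [← LinearMap.mem_ker, ← AdicCompletion.pow_smul_top_eq_ker_eval hI, ← Ideal.map_pow,
    Ideal.smul_top_eq_map]
  rfl

lemma AdicCompletion.exists_sub_algebraMap_mem (hI : I.FG) (n : ℕ) (c : AdicCompletion I P) :
    ∃ b, c - algebraMap P (AdicCompletion I P) b ∈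
      I.map (algebraMap P (AdicCompletion I P)) ^ n := by
  obtain ⟨b, hb⟩ := Submodule.mkQ_surjective _ (AdicCompletion.eval I P n c)
  refine ⟨b, ?_⟩
  rw [AdicCompletion.mem_map_pow_iff I hI, map_sub, sub_eq_zero, ← hb]
  rfl

lemma AdicCompletion.mem_pow_of_algebraMap_mem (hI : I.FG) (n : ℕ) (b : P)
    (hb : algebraMap P (AdicCompletion I P) b ∈
      I.map (algebraMap P (AdicCompletion I P)) ^ n) : b ∈ I ^ n := by
  rw [AdicCompletion.mem_map_pow_iff I hI] at hb
  have h : (I ^ n • ⊤ : Submodule P P).mkQ b = 0 := hb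
  rw [Submodule.mkQ_apply, Submodule.Quotient.mk_eq_zero] at h
  simpa using h

/-- The completion of a local ring at a finitely generated proper ideal is local. -/
lemma AdicCompletion.isLocalRing_of_le [IsLocalRing P] (hI : I.FG) (hle : I ≠ ⊤) :
    IsLocalRing (AdicCompletion I P) := by
  have := AdicCompletion.isAdicComplete_self I hI
  have : Nontrivial (P ⧸ I) := Ideal.Quotient.nontrivial_iff.mpr hle
  have hloc : IsLocalRing (P ⧸ I) :=
    IsLocalRing.of_surjective' (Ideal.Quotient.mk I) Ideal.Quotient.mk_surjective
  let f := (AdicCompletion.evalOneₐ I).toRingHom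
  have hker : RingHom.ker f = _ := AdicCompletion.ker_evalOneₐ_eq_map I hI
  have hf : IsLocalHom f := ⟨fun c hc ↦ by
    obtain ⟨u, hu⟩ := hc
    obtain ⟨d, hd⟩ := AdicCompletion.evalOneₐ_surjective I (↑u⁻¹ : P ⧸ I)
    have h1 : c * d - 1 ∈ RingHom.ker f := by
      have hd' : f d = ↑u⁻¹ := hd
      rw [RingHom.mem_ker, map_sub, map_mul, ← hu, hd', map_one, Units.mul_inv, sub_self]
    rw [hker] at h1
    have h2 := (Ideal.mem_jacobson_bot.mp (IsAdicComplete.le_jacobson_bot _ h1)) 1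
    rw [mul_one, sub_add_cancel] at h2
    exact isUnit_of_mul_isUnit_left h2⟩
  exact RingHom.domain_isLocalRing f

end AdicCompletion

/-- An element of the extension of an ideal `K` along a `p`-radical map has a `p`-power which comes
from the corresponding Frobenius power of `K`. -/
lemma exists_map_eq_pow_of_mem_map {L P : Type*} [CommRing L] [CommRing P] (f : L →+* P) (p : ℕ)
    [Fact p.Prime] [CharP L p] [CharP P p] [IsPRadical f p]
    {K : Ideal L} {z : P} (hz : z ∈ K.map f) :
    ∃ n, ∃ c ∈ K.map (iterateFrobenius L p n), f c = z ^ p ^ n := by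
  have hadd : ∀ {w : P} {n : ℕ} (k : ℕ), (∃ c ∈ K.map (iterateFrobenius L p n), f c = w ^ p ^ n) →
      ∃ c ∈ K.map (iterateFrobenius L p (n + k)), f c = w ^ p ^ (n + k) := by
    rintro w n k ⟨c, hc, hcw⟩
    refine ⟨iterateFrobenius L p k c, ?_, ?_⟩
    · rw [add_comm, iterateFrobenius_add, ← Ideal.map_map]
      exact Ideal.mem_map_of_mem _ hc
    · rw [iterateFrobenius_def, map_pow, hcw, ← pow_mul, pow_add]
  induction hz using Submodule.span_induction with
  | mem x h =>
    obtain ⟨c, hc, rfl⟩ := h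
    refine ⟨0, c, ?_, by simp⟩
    rw [iterateFrobenius_zero, Ideal.map_id]
    exact hc
  | zero => exact ⟨0, 0, zero_mem _, by simp⟩
  | add x y _ _ hx hy =>
    obtain ⟨m, hx⟩ := hx
    obtain ⟨n, hy⟩ := hy
    obtain ⟨c, hc, hcx⟩ := hadd n hx
    obtain ⟨d, hd, hdy⟩ := hadd m hy
    rw [add_comm n m] at hd hdy
    refine ⟨m + n, c + d, add_mem hc hd, ?_⟩
    rw [map_add, hcx, hdy, add_pow_char_pow]
  | smul a x _ hx =>
    obtain ⟨m, hx⟩ := hx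
    obtain ⟨n, y, hy⟩ := IsPRadical.pow_mem f p a
    obtain ⟨c, hc, hcx⟩ := hadd n hx
    refine ⟨m + n, y ^ p ^ m * c, Ideal.mul_mem_left _ _ hc, ?_⟩
    rw [map_mul, hcx, map_pow, hy, smul_eq_mul, mul_pow, ← pow_mul, ← pow_add, add_comm n m]

lemma exists_pow_eq_of_map_eq {L P : Type*} [CommRing L] [CommRing P] (f : L →+* P) (p : ℕ)
    [Fact p.Prime] [CharP L p] [IsPRadical f p]
    {a b : L} (h : f a = f b) : ∃ n, a ^ p ^ n = b ^ p ^ n := by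
  have h1 : a - b ∈ RingHom.ker f := by rw [RingHom.mem_ker, map_sub, h, sub_self]
  obtain ⟨n, hn⟩ := mem_pNilradical.mp (IsPRadical.ker_le f p h1)
  exact ⟨n, by rwa [sub_pow_char_pow, sub_eq_zero] at hn⟩

lemma Ideal.map_ne_top_of_isPRadical {L P : Type*} [CommRing L] [CommRing P] (f : L →+* P) (p : ℕ)
    [Fact p.Prime] [CharP L p] [CharP P p] [IsPRadical f p]
    {K : Ideal L} (hK : K ≠ ⊤) : K.map f ≠ ⊤ := by
  rw [Ideal.ne_top_iff_one] at hK ⊢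
  intro h
  obtain ⟨n, c, hc, hc1⟩ := exists_map_eq_pow_of_mem_map f p h
  obtain ⟨k, hk⟩ := exists_pow_eq_of_map_eq f p (a := c) (b := 1) (by rw [hc1, one_pow, map_one])
  have hp : 0 < p := (Fact.out : p.Prime).pos
  have hle : K.map (iterateFrobenius L p n) ≤ K := by
    rw [Ideal.map_le_iff_le_comap]
    intro x hx
    exact Ideal.pow_mem_of_mem _ hx _ (pow_pos hp n)
  apply hK
  rw [← one_pow (p ^ k), ← hk]
  exact Ideal.pow_mem_of_mem _ (hle hc) _ (pow_pos hp k)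

lemma IsLocalRing.of_isPRadical {L P : Type*} [CommRing L] [CommRing P] (f : L →+* P) (p : ℕ)
    [Fact p.Prime] [CharP P p] [IsPRadical f p]
    [IsLocalRing L] : IsLocalRing P := by
  have : Nontrivial P := CharP.nontrivial_of_char_ne_one (Fact.out : p.Prime).ne_one
  have hp : p ≠ 0 := (Fact.out : p.Prime).ne_zero
  refine IsLocalRing.of_isUnit_or_isUnit_one_sub_self fun x ↦ ?_
  obtain ⟨n, y, hy⟩ := IsPRadical.pow_mem f p x
  refine (IsLocalRing.isUnit_or_isUnit_one_sub_self y).imp (fun h ↦ ?_) (fun h ↦ ?_)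
  · rw [← isUnit_pow_iff (pow_ne_zero n hp), ← hy]
    exact h.map f
  · rw [← isUnit_pow_iff (pow_ne_zero n hp), sub_pow_char_pow, one_pow, ← hy, ← map_one f,
      ← map_sub]
    exact h.map f

open RingTheory.Sequence in
/-- Weakly regular sequences stay weakly regular in the perfect closure. -/
lemma isWeaklyRegular_map_of_isPRadical {L P : Type*} [CommRing L] [CommRing P] (f : L →+* P) (p : ℕ)
    [Fact p.Prime] [CharP L p] [CharP P p] [IsPRadical f p]
    [PerfectRing P p] {rs : List L}
    (h : IsWeaklyRegular L rs) : IsWeaklyRegular P (rs.map f) := by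
  rw [isWeaklyRegular_self_iff]
  intro i hlen z hz
  rw [List.length_map] at hlen
  rw [← List.map_take, ← Ideal.map_ofList] at hz ⊢
  rw [List.getElem_map] at hz
  obtain ⟨m, c, hc, hcz⟩ := exists_map_eq_pow_of_mem_map f p hz
  obtain ⟨n, y, hy⟩ := IsPRadical.pow_mem f p z
  have h1 : f (rs[i] ^ p ^ (m + n) * y ^ p ^ m) = f (c ^ p ^ n) := by
    rw [map_mul, map_pow, map_pow, map_pow, hy, hcz, ← pow_mul, ← pow_mul, ← pow_add, ← pow_add,
      mul_pow, add_comm n m]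
  obtain ⟨k, hk⟩ := exists_pow_eq_of_map_eq f p h1
  have hmap : ∀ N, Ideal.ofList ((rs.map (· ^ p ^ N)).take i) =
      (Ideal.ofList (rs.take i)).map (iterateFrobenius L p N) := fun N ↦ by
    rw [Ideal.map_ofList, ← List.map_take]
    rfl
  have hreg := isWeaklyRegular_self_iff.mp (isWeaklyRegular_map_pow (p ^ (m + n + k)) h) i
    (by simpa using hlen) (y ^ p ^ (m + k)) (by
      rw [hmap, List.getElem_map]
      convert_to iterateFrobenius L p (n + k) c ∈ _
      · rw [mul_pow, ← pow_mul, ← pow_mul, ← pow_mul, ← pow_add, ← pow_add, ← pow_add] at hk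
        rw [iterateFrobenius_def, hk]
      · rw [show m + n + k = (n + k) + m by ring, iterateFrobenius_add, ← Ideal.map_map]
        exact Ideal.mem_map_of_mem _ hc)
  rw [hmap] at hreg
  have h2 := Ideal.mem_map_of_mem f hreg
  rw [Ideal.map_map, show f.comp (iterateFrobenius L p (m + n + k)) =
      (iterateFrobenius P p (m + n + k)).comp f from
    RingHom.ext fun x ↦ f.map_iterateFrobenius p x _, ← Ideal.map_map, map_pow, hy, ← pow_mul,
    ← pow_add, show n + (m + k) = m + n + k by ring] at h2
  obtain ⟨w, hw, hwz⟩ := (Ideal.mem_map_iff_of_surjective _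
    (bijective_iterateFrobenius P p (m + n + k)).2).mp h2
  rwa [← (bijective_iterateFrobenius P p (m + n + k)).1 hwz]

section Parameters

variable {R : Type*} [CommRing R]

/-- No prime ideal lies strictly between a prime `P` and a prime minimal over `P + (a)`. -/
lemma Ideal.eq_of_lt_of_le_of_mem_minimalPrimes_sup_span [IsNoetherianRing R] {P Q M : Ideal R}
    [P.IsPrime] [Q.IsPrime] {a : R} (hM : M ∈ (P ⊔ Ideal.span {a}).minimalPrimes) (hPQ : P < Q)
    (hQM : Q ≤ M) : Q = M := by
  by_contra hne
  have hMp : M.IsPrime := hM.isPrime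
  let f := Ideal.Quotient.mk P
  have hf : Function.Surjective f := Ideal.Quotient.mk_surjective
  have hcomap : ∀ J : Ideal R, P ≤ J → (J.map f).comap f = J := fun J hJ ↦ by
    rw [Ideal.comap_map_of_surjective _ hf]
    exact sup_eq_left.mpr ((Ideal.mk_ker (I := P)).le.trans hJ)
  have hQ' : (Q.map f).IsPrime :=
    Ideal.map_isPrime_of_surjective hf ((Ideal.mk_ker (I := P)).le.trans hPQ.le)
  have hM' : (M.map f).IsPrime :=
    Ideal.map_isPrime_of_surjective hf ((Ideal.mk_ker (I := P)).le.trans (hPQ.le.trans hQM))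
  have hlt : Q.map f < M.map f := by
    refine lt_of_le_of_ne (Ideal.map_mono hQM) fun h ↦ hne ?_
    rw [← hcomap Q hPQ.le, h, hcomap M (hPQ.le.trans hQM)]
  have hlt' : (⊥ : Ideal (R ⧸ P)) < Q.map f := by
    refine bot_lt_iff_ne_bot.mpr fun h ↦ hPQ.ne ?_
    rw [← hcomap Q hPQ.le, h]
    exact (Ideal.mk_ker (I := P)).symm
  have h1 := Ideal.map_height_le_one_of_mem_minimalPrimes hM
  have h2 := Ideal.height_add_one_le_of_lt_of_isPrime hlt
  have h3 := Ideal.height_add_one_le_of_lt_of_isPrime hlt'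
  have h4 : (1 : ℕ∞) + 1 ≤ 1 :=
    (add_le_add_left (le_add_self.trans h3) 1).trans (h2.trans h1)
  exact absurd h4 (by decide)

variable [IsLocalRing R]

/-- A list of `dim R` elements of the maximal ideal of `R` generating an ideal primary to it. -/
structure IsParameterList (l : List R) : Prop where
  length_eq : (l.length : WithBot ℕ∞) = ringKrullDim R
  mem : ∀ x ∈ l, x ∈ maximalIdeal R
  le_radical : maximalIdeal R ≤ (Ideal.ofList l).radical

lemma IsParameterList.perm {l l' : List R} (h : IsParameterList l) (hp : l.Perm l') :
    IsParameterList l' where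
  length_eq := by rw [← hp.length_eq, h.length_eq]
  mem x hx := h.mem x (hp.mem_iff.mpr hx)
  le_radical := by
    have : Ideal.ofList l' = Ideal.ofList l := by
      simp only [Ideal.ofList, hp.mem_iff]
    rw [this]
    exact h.le_radical

lemma IsSOP.isParameterList {n : ℕ} {x : Fin n → R} (h : IsSOP R x) :
    IsParameterList (List.ofFn x) where
  length_eq := by rw [List.length_ofFn, h.1]
  mem y hy := by
    obtain ⟨i, rfl⟩ := List.mem_ofFn.mp hy
    exact h.2.1 i
  le_radical := by
    have : Ideal.ofList (List.ofFn x) = Ideal.span (Set.range x) := by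
      simp only [Ideal.ofList, List.mem_ofFn]
      rfl
    rw [this, h.2.2]

open RingTheory.Sequence in
/-- The last entry of a weakly regular system of parameters may be replaced. -/
lemma IsParameterList.isWeaklyRegular_append_singleton {M : Type*} [AddCommGroup M] [Module R M]
    {l : List R} {a z : R} (h : IsParameterList (l ++ [a])) (h' : IsParameterList (l ++ [z]))
    (hreg : IsWeaklyRegular M (l ++ [a])) : IsWeaklyRegular M (l ++ [z]) := by
  rw [isWeaklyRegular_append_iff, isWeaklyRegular_singleton_iff] at hreg ⊢
  refine ⟨hreg.1, isSMulRegular_iff_right_eq_zero_of_smul.mpr ?_⟩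
  intro q hq
  obtain ⟨n, hn⟩ := h'.le_radical (h.mem a (by simp))
  rw [Ideal.ofList_append, Ideal.ofList_singleton] at hn
  obtain ⟨s, hs, t, ht, hst⟩ := Submodule.mem_sup.mp hn
  obtain ⟨r, rfl⟩ := Ideal.mem_span_singleton'.mp ht
  have hsq : s • q = 0 := by
    obtain ⟨m, rfl⟩ := Submodule.mkQ_surjective _ q
    rw [← map_smul, Submodule.mkQ_apply, Submodule.Quotient.mk_eq_zero]
    exact Submodule.smul_mem_smul hs trivial
  refine (hreg.2.pow n).right_eq_zero_of_smul ?_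
  rw [← hst, add_smul, hsq, mul_smul, hq, smul_zero, zero_add]

variable [IsNoetherianRing R]

lemma IsParameterList.not_mem_minimalPrimes {l : List R} {a : R} (h : IsParameterList (l ++ [a])) :
    maximalIdeal R ∉ (Ideal.ofList l).minimalPrimes := by
  classical
  intro hm
  have h1 : (maximalIdeal R).height ≤ (l.toFinset.card : ℕ∞) := by
    refine Ideal.height_le_card_of_mem_minimalPrimes_span_finset ?_
    simpa [Ideal.ofList] using hm
  have h2 : (maximalIdeal R).height ≤ (l.length : ℕ∞) :=
    h1.trans (by exact_mod_cast l.toFinset_card_le)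
  have h3 : (((l.length + 1 : ℕ) : ℕ∞) : WithBot ℕ∞) = ((maximalIdeal R).height : WithBot ℕ∞) := by
    rw [IsLocalRing.maximalIdeal_height_eq_ringKrullDim, ← h.length_eq]
    simp
  rw [WithBot.coe_inj] at h3
  rw [← h3, Nat.cast_le] at h2
  omega

lemma IsParameterList.append_singleton {l : List R} {a z : R} (h : IsParameterList (l ++ [a]))
    (hz : z ∈ maximalIdeal R) (hz' : ∀ Q ∈ (Ideal.ofList l).minimalPrimes, z ∉ Q) :
    IsParameterList (l ++ [z]) where
  length_eq := by rw [← h.length_eq]; simp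
  mem x hx := by
    rcases List.mem_append.mp hx with hx | hx
    · exact h.mem x (by simp [hx])
    · rwa [List.mem_singleton.mp hx]
  le_radical := by
    rw [Ideal.radical_eq_sInf]
    refine le_sInf fun Q hQ ↦ ?_
    obtain ⟨hle, hQp⟩ := hQ
    rw [Ideal.ofList_append, Ideal.ofList_singleton, sup_le_iff,
      Ideal.span_singleton_le_iff_mem] at hle
    obtain ⟨P, hP, hPQ⟩ := Ideal.exists_minimalPrimes_le hle.1
    have hPp : P.IsPrime := hP.isPrime
    have hlt : P < Q := lt_of_le_of_ne hPQ (by rintro rfl; exact hz' _ hP hle.2)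
    have hQm : Q ≤ maximalIdeal R := IsLocalRing.le_maximalIdeal hQp.ne_top
    refine (Ideal.eq_of_lt_of_le_of_mem_minimalPrimes_sup_span (a := a) ?_ hlt hQm).ge
    refine ⟨⟨inferInstance, sup_le (hPQ.trans hQm) ?_⟩, fun J hJ _ ↦ ?_⟩
    · rw [Ideal.span_singleton_le_iff_mem]
      exact h.mem a (by simp)
    · refine h.le_radical.trans ((Ideal.IsPrime.radical_le_iff hJ.1).mpr ?_)
      rw [Ideal.ofList_append, Ideal.ofList_singleton]
      exact (sup_le_sup_right hP.le _).trans hJ.2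

/-- Two systems of parameters can be given a common last entry. -/
lemma IsParameterList.exists_append_singleton {l l' : List R} {a b : R}
    (h : IsParameterList (l ++ [a])) (h' : IsParameterList (l' ++ [b])) :
    ∃ z, IsParameterList (l ++ [z]) ∧ IsParameterList (l' ++ [z]) := by
  set s := (Ideal.ofList l).minimalPrimes ∪ (Ideal.ofList l').minimalPrimes with hs
  have hfin : s.Finite := (Ideal.finite_minimalPrimes_of_isNoetherianRing R _).union
    (Ideal.finite_minimalPrimes_of_isNoetherianRing R _)
  have hprime : ∀ Q ∈ s, Q.IsPrime := by
    rintro Q (hQ | hQ) <;> exact hQ.isPrime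
  have hne : ∀ Q ∈ s, ¬ maximalIdeal R ≤ Q := by
    intro Q hQ hle
    have heq := (maximalIdeal.isMaximal R).eq_of_le (hprime Q hQ).ne_top hle
    rcases hQ with hQ | hQ
    · exact h.not_mem_minimalPrimes (heq ▸ hQ)
    · exact h'.not_mem_minimalPrimes (heq ▸ hQ)
  have hcover : ¬ (maximalIdeal R : Set R) ⊆ ⋃ Q ∈ s, (Q : Set R) := by
    intro hsub
    obtain ⟨Q, hQ, hle⟩ := (Ideal.subset_union_prime_finite hfin (f := id) ⊥ ⊥
      (fun Q hQ _ _ ↦ hprime Q hQ)).mp hsub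
    exact hne Q hQ hle
  obtain ⟨z, hz, hz'⟩ := Set.not_subset.mp hcover
  simp only [Set.mem_iUnion, not_exists, SetLike.mem_coe] at hz'
  exact ⟨z, h.append_singleton hz fun Q hQ ↦ hz' Q (Or.inl hQ),
    h'.append_singleton hz fun Q hQ ↦ hz' Q (Or.inr hQ)⟩

open RingTheory.Sequence in
/-- If one system of parameters is weakly regular on an `m`-adically complete algebra, so is every
system of parameters. -/
lemma IsParameterList.isWeaklyRegular_of_isAdicComplete {C : Type*} [CommRing C] [Algebra R C]
    [IsAdicComplete ((maximalIdeal R).map (algebraMap R C)) C] (x : List R) :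
    ∀ (w y : List R), x.length = y.length → IsParameterList (w ++ x) → IsParameterList (w ++ y) →
      IsWeaklyRegular C (w ++ x) → IsWeaklyRegular C (w ++ y) := by
  have hperm : ∀ {u v : List R}, IsParameterList u → u.Perm v → IsWeaklyRegular C u →
      IsWeaklyRegular C v := by
    intro u v hu huv hreg
    rw [← isWeaklyRegular_map_algebraMap_iff C C] at hreg ⊢
    refine isWeaklyRegular_perm_of_isAdicComplete
      (I := (maximalIdeal R).map (algebraMap R C)) hreg (huv.map _) ?_
    intro r hr
    obtain ⟨a, ha, rfl⟩ := List.mem_map.mp hr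
    exact Ideal.mem_map_of_mem _ (hu.mem a ha)
  induction x using List.reverseRecOn with
  | nil =>
    intro w y hlen _ _ h
    rwa [List.length_eq_zero_iff.mp hlen.symm]
  | append_singleton x a ih =>
    intro w y hlen hx hy h
    rcases List.eq_nil_or_concat y with rfl | ⟨y, b, rfl⟩
    · simp at hlen
    rw [List.concat_eq_append] at *
    rw [← List.append_assoc] at hx hy h ⊢
    obtain ⟨z, hxz, hyz⟩ := hx.exists_append_singleton hy
    have hp : ∀ u : List R, (w ++ u ++ [z]).Perm (w ++ [z] ++ u) := fun u ↦ by
      rw [List.append_assoc, List.append_assoc]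
      exact List.perm_append_comm.append_left w
    have h1 := hperm hxz (hp x) (hx.isWeaklyRegular_append_singleton hxz h)
    have h2 := ih (w ++ [z]) y (by simpa using hlen) (hxz.perm (hp x)) (hyz.perm (hp y)) h1
    exact hyz.isWeaklyRegular_append_singleton hy (hperm (hyz.perm (hp y)) (hp y).symm h2)

end Parameters

/-- A nontrivial algebra over a ring of prime characteristic `p` has characteristic `p`. -/
lemma charP_of_nontrivial_algebra (R A : Type*) [CommRing R] [CommRing A] [Algebra R A]
    [Nontrivial A] (p : ℕ) [hp : Fact p.Prime] [CharP R p] : CharP A p := by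
  rw [CharP.charP_iff_prime_eq_zero hp.out, ← map_natCast (algebraMap R A), CharP.cast_eq_zero,
    map_zero]

open RingTheory.Sequence in
lemma isBalancedBigCM_of_isAdicComplete {R : Type*} [CommRing R] [IsLocalRing R]
    [IsNoetherianRing R] {C : Type*} [CommRing C] [Algebra R C]
    [IsAdicComplete ((maximalIdeal R).map (algebraMap R C)) C]
    (hne : (maximalIdeal R).map (algebraMap R C) ≠ ⊤) {n : ℕ} {x : Fin n → R} (hx : IsSOP R x)
    (hreg : IsWeaklyRegular C (List.ofFn x)) : IsBalancedBigCM R C := by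
  refine ⟨fun k y hy ↦ ⟨?_, ?_⟩, hne⟩
  · have hlen : (List.ofFn x).length = (List.ofFn y).length := by
      have h : ((n : ℕ∞) : WithBot ℕ∞) = ((k : ℕ∞) : WithBot ℕ∞) := hx.1.trans hy.1.symm
      rw [WithBot.coe_inj, Nat.cast_inj] at h
      simpa using h
    exact IsParameterList.isWeaklyRegular_of_isAdicComplete (List.ofFn x) [] (List.ofFn y) hlen
      hx.isParameterList hy.isParameterList hreg
  · intro htop
    apply hne
    rw [eq_top_iff]
    intro c _
    have hc : c ∈ (Ideal.ofList (List.ofFn y) • ⊤ : Submodule R C) := htop ▸ trivial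
    rw [Ideal.smul_top_eq_map] at hc
    refine Ideal.map_mono ?_ hc
    rw [Ideal.span_le]
    exact hy.isParameterList.mem

open RingTheory.Sequence in
/-- A perfect local algebra on which a system of parameters is weakly regular has a completion
which is a perfect, separated, local, balanced big Cohen-Macaulay algebra. -/
lemma exists_completion_of_perfectRing {R : Type*} [CommRing R] [IsLocalRing R]
    [IsNoetherianRing R] (p : ℕ) [Fact p.Prime] [CharP R p] (P : Type w) [CommRing P] [Algebra R P]
    [IsLocalRing P] [CharP P p] [PerfectRing P p] {n : ℕ} {x : Fin n → R} (hx : IsSOP R x)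
    (hreg : IsWeaklyRegular P (List.ofFn x))
    (hne : (maximalIdeal R).map (algebraMap R P) ≠ ⊤) :
    ∃ (C : Type w) (_ : CommRing C) (_ : Algebra R C),
      IsBalancedBigCM R C ∧ IsReduced C ∧ Function.Bijective (fun c : C ↦ c ^ p) ∧
      IsLocalRing C ∧ (⨅ k : ℕ, ((maximalIdeal R) ^ (k + 1)).map (algebraMap R C)) = ⊥ ∧
      Nonempty (P →ₐ[R] C) := by
  set I := (maximalIdeal R).map (algebraMap R P)
  have hfg : I.FG := Ideal.FG.map (IsNoetherian.noetherian (maximalIdeal R)) _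
  let C := AdicCompletion I P
  have hmap : (maximalIdeal R).map (algebraMap R C) = I.map (algebraMap P C) := by
    rw [IsScalarTower.algebraMap_eq R P C, ← Ideal.map_map]
  have hs : ∀ n, ∀ c : C, ∃ b, c - algebraMap P C b ∈ I.map (algebraMap P C) ^ n :=
    AdicCompletion.exists_sub_algebraMap_mem I hfg
  have hi : ∀ n b, algebraMap P C b ∈ I.map (algebraMap P C) ^ n → b ∈ I ^ n :=
    AdicCompletion.mem_pow_of_algebraMap_mem I hfg
  have hcomplete : IsAdicComplete (I.map (algebraMap P C)) C :=
    AdicCompletion.isAdicComplete_self I hfg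
  have hcomplete' : IsAdicComplete ((maximalIdeal R).map (algebraMap R C)) C := by rwa [hmap]
  have hlocal : IsLocalRing C := AdicCompletion.isLocalRing_of_le I hfg hne
  have hchar : CharP C p := charP_of_nontrivial_algebra R C p
  have hbij : Function.Bijective (frobenius C p) := bijective_frobenius_of_completion p hs hi hfg
  have hred : IsReduced C := (isReduced_iff_pow_one_lt p (Fact.out : p.Prime).one_lt).mpr
    fun c hc ↦ (map_eq_zero_iff _ hbij.1).mp hc
  have hneC : (maximalIdeal R).map (algebraMap R C) ≠ ⊤ := by
    rw [hmap, Ideal.ne_top_iff_one]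
    rw [Ideal.ne_top_iff_one] at hne
    intro h
    refine hne ?_
    simpa using hi 1 1 (by simpa using h)
  have hregP : IsWeaklyRegular P ((List.ofFn x).map (algebraMap R P)) :=
    (isWeaklyRegular_map_algebraMap_iff P P _).mpr hreg
  have hregC := isWeaklyRegular_map_of_completion hs hi hregP hfg
    (fun y hy ↦ by
      obtain ⟨r, hr, rfl⟩ := List.mem_map.mp hy
      exact Ideal.mem_map_of_mem _ (hx.isParameterList.mem r hr))
    (by
      rw [← Ideal.map_ofList]
      exact (Ideal.map_mono hx.isParameterList.le_radical).trans (Ideal.map_radical_le _))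
  rw [List.map_map, ← RingHom.coe_comp, ← IsScalarTower.algebraMap_eq R P C,
    isWeaklyRegular_map_algebraMap_iff C C] at hregC
  refine ⟨C, inferInstance, inferInstance, isBalancedBigCM_of_isAdicComplete hneC hx hregC,
    hred, hbij, hlocal, ?_, ⟨IsScalarTower.toAlgHom R P C⟩⟩
  rw [eq_bot_iff]
  intro c hc
  refine eq_zero_of_forall_mem_pow (I := I.map (algebraMap P C)) fun k ↦ ?_
  have h := (Ideal.mem_iInf.mp hc) k
  rw [Ideal.map_pow, hmap] at h
  exact Ideal.pow_le_pow_right k.le_succ h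

open RingTheory.Sequence in
/-- A big Cohen-Macaulay algebra maps to a perfect local algebra on which a system of parameters is
still weakly regular. -/
lemma IsBigCM.exists_perfectRing {R : Type*} [CommRing R] [IsLocalRing R] (p : ℕ) [Fact p.Prime]
    [CharP R p] {B : Type w} [CommRing B] [Algebra R B] (hB : IsBigCM R B) :
    ∃ (P : Type w) (_ : CommRing P) (_ : Algebra R P) (_ : IsLocalRing P) (_ : CharP P p)
      (_ : PerfectRing P p) (n : ℕ) (x : Fin n → R), IsSOP R x ∧
      IsWeaklyRegular P (List.ofFn x) ∧ (maximalIdeal R).map (algebraMap R P) ≠ ⊤ ∧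
      Nonempty (B →ₐ[R] P) := by
  obtain ⟨⟨n, x, hx, hreg⟩, hne⟩ := hB
  obtain ⟨N, hN, hle⟩ := Ideal.exists_le_maximal _ hne
  let L := Localization.AtPrime N
  have hchar : CharP L p := charP_of_nontrivial_algebra R L p
  let P := PerfectClosure L p
  let f : L →+* P := PerfectClosure.of L p
  have hf : IsPRadical f p := PerfectClosure.isPRadical L p
  let _ : Algebra R P := (f.comp (algebraMap R L)).toAlgebra
  have hregL : IsWeaklyRegular L (((List.ofFn x).map (algebraMap R B)).map (algebraMap B L)) :=
    IsWeaklyRegular.of_isLocalization L N.primeCompl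
      ((isWeaklyRegular_map_algebraMap_iff B B _).mpr hreg.toIsWeaklyRegular)
  rw [List.map_map, ← RingHom.coe_comp, ← IsScalarTower.algebraMap_eq R B L] at hregL
  have hregP := isWeaklyRegular_map_of_isPRadical f p hregL
  rw [List.map_map, ← RingHom.coe_comp] at hregP
  have hneL : (maximalIdeal R).map (algebraMap R L) ≠ ⊤ := by
    rw [IsScalarTower.algebraMap_eq R B L, ← Ideal.map_map]
    refine ne_top_of_le_ne_top (IsLocalRing.maximalIdeal.isMaximal L).ne_top
      ((Ideal.map_mono hle).trans ?_)
    rw [Localization.AtPrime.map_eq_maximalIdeal]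
  let g : L →ₐ[R] P := { f with commutes' := fun _ ↦ rfl }
  refine ⟨P, inferInstance, inferInstance, IsLocalRing.of_isPRadical f p, inferInstance,
    inferInstance, n, x, hx, (isWeaklyRegular_map_algebraMap_iff P P _).mp hregP, ?_,
    ⟨g.comp (IsScalarTower.toAlgHom R B L)⟩⟩
  rw [show algebraMap R P = f.comp (algebraMap R L) from rfl, ← Ideal.map_map]
  exact Ideal.map_ne_top_of_isPRadical f p hneL

/-- **Proposition (Dietz, Prop. 3.6 / `goodbigC-M`).** Let `(R,m)` be a Noetherian local
ring of positive prime characteristic `p`. Every seed over `R` maps to a balanced big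
Cohen-Macaulay `R`-algebra `B` that is reduced, perfect (Frobenius is bijective),
quasilocal, and `m`-adically separated. -/
theorem seed_maps_to_reduced_perfect_bigCM
    (R : Type u) [CommRing R] [IsLocalRing R] [IsNoetherianRing R]
    (p : ℕ) [Fact p.Prime] [CharP R p]
    (S : Type v) [CommRing S] [Algebra R S] (hS : IsSeed R S) :
    ∃ (B : Type (max u v)) (_ : CommRing B) (_ : Algebra R B),
      IsBalancedBigCM R B ∧ IsReduced B ∧
      Function.Bijective (fun b : B => b ^ p) ∧
      IsLocalRing B ∧
      (⨅ k : ℕ, ((maximalIdeal R) ^ (k + 1)).map (algebraMap R B)) = ⊥ ∧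
      Nonempty (S →ₐ[R] B) := by
  obtain ⟨B, _, _, hB, ⟨φ⟩⟩ := hS
  obtain ⟨P, _, _, _, _, _, n, x, hx, hreg, hne, ⟨ψ⟩⟩ := hB.exists_perfectRing p
  obtain ⟨C, _, _, hC, hred, hbij, hloc, hsep, ⟨χ⟩⟩ :=
    exists_completion_of_perfectRing p P hx hreg hne
  exact ⟨C, _, _, hC, hred, hbij, hloc, hsep, ⟨χ.comp (ψ.comp φ)⟩⟩
end

section
/- Let (R,m) be a Noetherian local ring and let S = colim_λ S_λ be the direct limit of a directed system of R-algebras S_λ. Then S is a seed over R if and only if every S_λ is a seed over R. -/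
open IsLocalRing

universe u v w

/-! ### Regularity and asymptotic regularity modulo an ideal -/

namespace SeedLimit

section Module

variable {R : Type*} [CommRing R] {M : Type*} [AddCommGroup M] [Module R M]

theorem mem_sup_span_singleton_smul_top {𝔞 : Ideal R} {r : R} {b : M} :
    b ∈ (𝔞 ⊔ Ideal.span {r}) • (⊤ : Submodule R M) ↔
      ∃ c : M, b - r • c ∈ 𝔞 • (⊤ : Submodule R M) := by
  rw [Submodule.sup_smul, Submodule.ideal_span_singleton_smul, Submodule.mem_sup]
  constructor
  · rintro ⟨a, ha, y, hy, rfl⟩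
    obtain ⟨c, -, rfl⟩ := (Submodule.mem_smul_pointwise_iff_exists _ _ _).1 hy
    exact ⟨c, by simpa using ha⟩
  · rintro ⟨c, hc⟩
    exact ⟨_, hc, r • c, Submodule.smul_mem_pointwise_smul _ _ _ trivial, by simp⟩

theorem mem_smul_top_of_le {𝔞 𝔟 : Ideal R} (h : 𝔞 ≤ 𝔟) {b : M}
    (hb : b ∈ 𝔞 • (⊤ : Submodule R M)) : b ∈ 𝔟 • (⊤ : Submodule R M) :=
  Submodule.smul_mono_left h hb

variable (M) in
/-- `r` is a nonzerodivisor on `M / 𝔞M`. -/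
def RegMod (𝔞 : Ideal R) (r : R) : Prop :=
  ∀ b : M, r • b ∈ 𝔞 • (⊤ : Submodule R M) → b ∈ 𝔞 • (⊤ : Submodule R M)

variable (M) in
/-- Multiplication by `r` on `M / 𝔞M` is injective with continuous inverse for the `I`-adic
topology, up to elements in the closure of zero. -/
def AsympRegMod (I 𝔞 : Ideal R) (r : R) : Prop :=
  ∀ n : ℕ, ∃ m : ℕ, ∀ b : M, r • b ∈ (𝔞 ⊔ I ^ m) • (⊤ : Submodule R M) →
    b ∈ (𝔞 ⊔ I ^ n) • (⊤ : Submodule R M)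

/-- Each entry of a list satisfies `P` relative to `𝔞` plus the ideal of the earlier entries. -/
def SeqHolds (P : Ideal R → R → Prop) : Ideal R → List R → Prop
  | _, [] => True
  | 𝔞, r :: l => P 𝔞 r ∧ SeqHolds P (𝔞 ⊔ Ideal.span {r}) l

theorem SeqHolds.imp {P Q : Ideal R → R → Prop} (h : ∀ 𝔞 r, P 𝔞 r → Q 𝔞 r) :
    ∀ {𝔞 : Ideal R} {l : List R}, SeqHolds P 𝔞 l → SeqHolds Q 𝔞 l
  | _, [], _ => trivial
  | _, _ :: _, hl => ⟨h _ _ hl.1, hl.2.imp h⟩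

theorem seqHolds_append {P : Ideal R → R → Prop} : ∀ {𝔞 : Ideal R} {l l' : List R},
    SeqHolds P 𝔞 (l ++ l') ↔ SeqHolds P 𝔞 l ∧ SeqHolds P (𝔞 ⊔ Ideal.ofList l) l'
  | 𝔞, [], l' => by simp [SeqHolds]
  | 𝔞, r :: l, l' => by
    rw [List.cons_append, SeqHolds, SeqHolds, seqHolds_append, Ideal.ofList_cons, and_assoc,
      sup_assoc]

theorem seqHolds_iff {P : Ideal R → R → Prop} : ∀ {𝔞 : Ideal R} {l : List R},
    SeqHolds P 𝔞 l ↔ ∀ i (h : i < l.length), P (𝔞 ⊔ Ideal.ofList (l.take i)) l[i]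
  | 𝔞, [] => by simp [SeqHolds]
  | 𝔞, r :: l => by
    rw [SeqHolds, seqHolds_iff]
    constructor
    · rintro ⟨h0, h⟩ (_ | i) hi
      · simpa using h0
      · simpa [sup_assoc] using h i (by simpa using hi)
    · intro h
      refine ⟨by simpa using! h 0 (by simp), fun i hi => ?_⟩
      simpa [sup_assoc] using! h (i + 1) (by simpa using hi)

theorem isWeaklyRegular_iff_seqHolds {l : List R} :
    RingTheory.Sequence.IsWeaklyRegular M l ↔ SeqHolds (RegMod M) ⊥ l := by
  simp only [RingTheory.Sequence.isWeaklyRegular_iff, seqHolds_iff, bot_sup_eq, RegMod,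
    isSMulRegular_quotient_iff_mem_of_smul_mem]

theorem AsympRegMod.exists_ge {I 𝔞 : Ideal R} {r : R} (h : AsympRegMod M I 𝔞 r) (n : ℕ) :
    ∃ m, n ≤ m ∧ ∀ b : M, r • b ∈ (𝔞 ⊔ I ^ m) • (⊤ : Submodule R M) →
      b ∈ (𝔞 ⊔ I ^ n) • (⊤ : Submodule R M) := by
  obtain ⟨m, hm⟩ := h n
  exact ⟨max m n, le_max_right _ _, fun b hb => hm b
    (mem_smul_top_of_le (sup_le_sup_left (Ideal.pow_le_pow_right (le_max_left _ _)) _) hb)⟩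

/-! ### Permuting asymptotically regular sequences -/

theorem AsympRegMod.sup_span {I 𝔞 : Ideal R} {x z : R} (hx : AsympRegMod M I 𝔞 x)
    (hz : AsympRegMod M I (𝔞 ⊔ Ideal.span {x}) z) :
    AsympRegMod M I (𝔞 ⊔ Ideal.span {z}) x := by
  intro n
  obtain ⟨m₁, -, h₁⟩ := hx.exists_ge n
  obtain ⟨m₂, h₁₂, h₂⟩ := hz.exists_ge m₁
  refine ⟨m₂, fun b hb => ?_⟩
  rw [sup_right_comm] at hb ⊢
  obtain ⟨c, hc⟩ := mem_sup_span_singleton_smul_top.1 hb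
  have hc' : c ∈ (𝔞 ⊔ Ideal.span {x} ⊔ I ^ m₁) • (⊤ : Submodule R M) := by
    refine h₂ c ?_
    rw [sup_right_comm]
    refine mem_sup_span_singleton_smul_top.2 ⟨b, ?_⟩
    rw [← neg_sub]
    exact neg_mem hc
  rw [sup_right_comm] at hc'
  obtain ⟨c', hc'⟩ := mem_sup_span_singleton_smul_top.1 hc'
  refine mem_sup_span_singleton_smul_top.2 ⟨c', h₁ _ ?_⟩
  have e : x • (b - z • c') = (x • b - z • c) + z • (c - x • c') := by
    rw [smul_sub, smul_sub, smul_comm x z]; abel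
  rw [e]
  exact add_mem (mem_smul_top_of_le (sup_le_sup_left (Ideal.pow_le_pow_right h₁₂) _) hc)
    (Submodule.smul_mem _ _ hc')

theorem AsympRegMod.of_sup_span {I 𝔞 : Ideal R} {x z : R} (hxI : x ∈ I)
    (hx : AsympRegMod M I 𝔞 x) (hz : AsympRegMod M I (𝔞 ⊔ Ideal.span {x}) z) :
    AsympRegMod M I 𝔞 z := by
  intro n
  induction n with
  | zero => exact ⟨0, fun b _ => by simp⟩
  | succ n ih =>
    obtain ⟨m₁, h₁⟩ := ih
    obtain ⟨m₂, -, h₂⟩ := hx.exists_ge m₁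
    obtain ⟨m₃, h₂₃, h₃⟩ := hz.exists_ge (max m₂ (n + 1))
    refine ⟨m₃, fun b hb => ?_⟩
    have hb' := h₃ b (mem_smul_top_of_le (sup_le_sup_right le_sup_left _) hb)
    rw [sup_right_comm] at hb'
    obtain ⟨b', hb'⟩ := mem_sup_span_singleton_smul_top.1 hb'
    have h : b' ∈ (𝔞 ⊔ I ^ n) • (⊤ : Submodule R M) := by
      refine h₁ _ (h₂ _ ?_)
      have e : x • z • b' = z • b - z • (b - x • b') := by
        rw [smul_sub, smul_comm x z]; abel
      rw [e]
      refine sub_mem (mem_smul_top_of_le (sup_le_sup_left (Ideal.pow_le_pow_right ?_) _) hb)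
        (Submodule.smul_mem _ _
          (mem_smul_top_of_le (sup_le_sup_left (Ideal.pow_le_pow_right ?_) _) hb'))
      · exact (le_max_left _ _).trans h₂₃
      · exact le_max_left _ _
    have hxb : x • b' ∈ (𝔞 ⊔ I ^ (n + 1)) • (⊤ : Submodule R M) := by
      have : x • b' ∈ Ideal.span {x} • (𝔞 ⊔ I ^ n) • (⊤ : Submodule R M) :=
        Submodule.smul_mem_smul (Ideal.mem_span_singleton_self x) h
      rw [← Submodule.mul_smul] at this
      refine mem_smul_top_of_le ?_ this
      rw [Ideal.mul_sup]
      refine sup_le_sup Ideal.mul_le_right ?_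
      rw [pow_succ']
      exact Ideal.mul_mono_left ((Ideal.span_singleton_le_iff_mem _).2 hxI)
    have e : b = (b - x • b') + x • b' := by abel
    rw [e]
    exact add_mem
      (mem_smul_top_of_le (sup_le_sup_left (Ideal.pow_le_pow_right (le_max_right _ _)) _) hb') hxb

theorem AsympRegMod.of_pow_mem {I 𝔞 : Ideal R} {u z : R} {t : ℕ} (hu : AsympRegMod M I 𝔞 u)
    (h : u ^ t ∈ 𝔞 ⊔ Ideal.span {z}) : AsympRegMod M I 𝔞 z := by
  have key : ∀ k n, ∃ m, ∀ b : M, u ^ k • b ∈ (𝔞 ⊔ I ^ m) • (⊤ : Submodule R M) →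
      b ∈ (𝔞 ⊔ I ^ n) • (⊤ : Submodule R M) := by
    intro k
    induction k with
    | zero => exact fun n => ⟨n, fun b hb => by simpa using hb⟩
    | succ k ih =>
      intro n
      obtain ⟨m₁, h₁⟩ := hu n
      obtain ⟨m₂, h₂⟩ := ih m₁
      exact ⟨m₂, fun b hb => h₁ _ (h₂ _ (by rwa [smul_smul, ← pow_succ]))⟩
  intro n
  obtain ⟨m, hm⟩ := key t n
  refine ⟨m, fun b hb => hm b ?_⟩
  obtain ⟨a, ha, s, hs, e⟩ := Submodule.mem_sup.1 h
  obtain ⟨c, rfl⟩ := Ideal.mem_span_singleton'.1 hs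
  rw [← e, add_smul, mul_smul]
  exact add_mem (mem_smul_top_of_le le_sup_left (Submodule.smul_mem_smul ha trivial))
    (Submodule.smul_mem _ _ hb)

theorem SeqHolds.perm {I : Ideal R} {l l' : List R} (h : l.Perm l') (hI : ∀ r ∈ l, r ∈ I)
    {𝔞 : Ideal R} (hl : SeqHolds (AsympRegMod M I) 𝔞 l) :
    SeqHolds (AsympRegMod M I) 𝔞 l' := by
  induction h generalizing 𝔞 with
  | nil => exact hl
  | cons x _ ih => exact ⟨hl.1, ih (fun r hr => hI r (List.mem_cons_of_mem _ hr)) hl.2⟩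
  | swap x y l =>
    obtain ⟨h₁, h₂, h₃⟩ := hl
    exact ⟨h₁.of_sup_span (hI _ (by simp)) h₂, h₁.sup_span h₂, by rwa [sup_right_comm]⟩
  | trans h₁ _ ih₁ ih₂ => exact ih₂ (fun r hr => hI r (h₁.mem_iff.2 hr)) (ih₁ hI hl)

/-! ### Regular sequences are asymptotically regular -/

theorem RegMod.sup_span {𝔞 : Ideal R} {x z : R} (hx : RegMod M 𝔞 x)
    (hz : RegMod M (𝔞 ⊔ Ideal.span {x}) z) : RegMod M (𝔞 ⊔ Ideal.span {z}) x := by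
  intro b hb
  obtain ⟨c, hc⟩ := mem_sup_span_singleton_smul_top.1 hb
  have hc' := hz c (mem_sup_span_singleton_smul_top.2 ⟨b, by rw [← neg_sub]; exact neg_mem hc⟩)
  obtain ⟨c', hc'⟩ := mem_sup_span_singleton_smul_top.1 hc'
  refine mem_sup_span_singleton_smul_top.2 ⟨c', hx _ ?_⟩
  have e : x • (b - z • c') = (x • b - z • c) + z • (c - x • c') := by
    rw [smul_sub, smul_sub, smul_comm x z]; abel
  rw [e]
  exact add_mem hc (Submodule.smul_mem _ _ hc')

theorem RegMod.pow {𝔞 : Ideal R} {x : R} (hx : RegMod M 𝔞 x) (t : ℕ) : RegMod M 𝔞 (x ^ t) := by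
  induction t with
  | zero => exact fun b hb => by simpa using hb
  | succ t ih => exact fun b hb => hx _ (ih _ (by rwa [smul_smul, ← pow_succ]))

theorem RegMod.sup_span_pow {𝔞 : Ideal R} {w v : R} (hw : RegMod M 𝔞 w)
    (hv : RegMod M (𝔞 ⊔ Ideal.span {w}) v) (t : ℕ) : RegMod M (𝔞 ⊔ Ideal.span {w ^ t}) v := by
  induction t with
  | zero => exact fun b _ => by simp
  | succ t ih =>
    intro b hb
    obtain ⟨c, hc⟩ := mem_sup_span_singleton_smul_top.1 hb
    obtain ⟨b', hb'⟩ := mem_sup_span_singleton_smul_top.1 (ih b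
      (mem_sup_span_singleton_smul_top.2 ⟨w • c, by rwa [smul_smul, ← pow_succ]⟩))
    have h : w ^ t • (v • b' - w • c) ∈ 𝔞 • (⊤ : Submodule R M) := by
      have e : w ^ t • (v • b' - w • c) =
          (v • b - w ^ (t + 1) • c) - v • (b - w ^ t • b') := by
        rw [smul_sub, smul_sub, smul_comm v (w ^ t), pow_succ, mul_smul]; abel
      rw [e]
      exact sub_mem hc (Submodule.smul_mem _ _ hb')
    obtain ⟨d, hd⟩ := mem_sup_span_singleton_smul_top.1
      (hv b' (mem_sup_span_singleton_smul_top.2 ⟨c, hw.pow t _ h⟩))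
    refine mem_sup_span_singleton_smul_top.2 ⟨d, ?_⟩
    have e : b - w ^ (t + 1) • d = (b - w ^ t • b') + w ^ t • (b' - w • d) := by
      rw [smul_sub, pow_succ, mul_smul]; abel
    rw [e]
    exact add_mem hb' (Submodule.smul_mem _ _ hd)

theorem SeqHolds.sup_span_pow {𝔞 : Ideal R} {w : R} {l : List R} (hw : RegMod M 𝔞 w)
    (hl : SeqHolds (RegMod M) (𝔞 ⊔ Ideal.span {w}) l) (t : ℕ) :
    SeqHolds (RegMod M) (𝔞 ⊔ Ideal.span {w ^ t}) l := by
  induction l generalizing 𝔞 with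
  | nil => trivial
  | cons v l ih =>
    refine ⟨hw.sup_span_pow hl.1 t, ?_⟩
    rw [sup_right_comm]
    refine ih (hw.sup_span hl.1) ?_
    rw [sup_right_comm]
    exact hl.2

theorem pow_le_sup_span_pow {I 𝔞 : Ideal R} {w : R} {N : ℕ} (h : I ^ N ≤ 𝔞 ⊔ Ideal.span {w})
    (t : ℕ) : I ^ (N * t) ≤ 𝔞 ⊔ Ideal.span {w ^ t} := by
  rw [pow_mul]
  refine (Ideal.pow_right_mono h t).trans ?_
  induction t with
  | zero => simp
  | succ t ih =>
    rw [pow_succ, pow_succ, ← Ideal.span_singleton_mul_span_singleton]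
    refine (Ideal.mul_mono_left ih).trans ?_
    rw [Ideal.sup_mul, Ideal.mul_sup (Ideal.span {w ^ t})]
    exact sup_le (Ideal.mul_le_left.trans le_sup_left)
      (sup_le_sup_right Ideal.mul_le_right _)

theorem AsympRegMod.of_regMod {I 𝔞 : Ideal R} {z : R} {l : List R} {N : ℕ}
    (hI : ∀ r ∈ z :: l, r ∈ I) (hl : SeqHolds (RegMod M) 𝔞 (z :: l))
    (hN : I ^ N ≤ 𝔞 ⊔ Ideal.ofList (z :: l)) : AsympRegMod M I 𝔞 z := by
  have pow_le {r : R} (hr : r ∈ I) (n : ℕ) : Ideal.span {r ^ n} ≤ I ^ n :=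
    (Ideal.span_singleton_le_iff_mem _).2 (Ideal.pow_mem_pow hr n)
  induction l generalizing 𝔞 N with
  | nil =>
    intro n
    rw [Ideal.ofList_singleton] at hN
    refine ⟨N * (n + 1), fun b hb => ?_⟩
    obtain ⟨c, hc⟩ := mem_sup_span_singleton_smul_top.1
      (mem_smul_top_of_le (sup_le le_sup_left (pow_le_sup_span_pow hN (n + 1))) hb)
    have h := hl.1 (b - z ^ n • c) (by rwa [smul_sub, smul_smul, ← pow_succ'])
    exact mem_smul_top_of_le (sup_le_sup_left (pow_le (hI z (by simp)) n) _)
      (mem_sup_span_singleton_smul_top.2 ⟨c, h⟩)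
  | cons w l ih =>
    intro n
    obtain ⟨h₁, h₂, h₃⟩ := hl
    have hN' : I ^ (N * n) ≤ 𝔞 ⊔ Ideal.span {w ^ n} ⊔ Ideal.ofList (z :: l) := by
      have : I ^ N ≤ (𝔞 ⊔ Ideal.ofList (z :: l)) ⊔ Ideal.span {w} := by
        refine hN.trans (le_of_eq ?_)
        simp only [Ideal.ofList_cons]
        ac_rfl
      rw [sup_right_comm]
      exact pow_le_sup_span_pow this n
    have hreg : SeqHolds (RegMod M) (𝔞 ⊔ Ideal.span {w ^ n}) (z :: l) := by
      refine ⟨h₁.sup_span (h₂.pow n), ?_⟩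
      rw [sup_right_comm]
      exact SeqHolds.sup_span_pow h₂ h₃ n
    obtain ⟨m, hm⟩ := ih (fun r hr => hI r (by simp_all; tauto)) hreg hN' n
    refine ⟨m, fun b hb => ?_⟩
    refine mem_smul_top_of_le ?_ (hm b (mem_smul_top_of_le (sup_le_sup_right le_sup_left _) hb))
    exact sup_le (sup_le_sup_left (pow_le (hI w (by simp)) n) _) le_sup_right

theorem SeqHolds.asympRegMod {I 𝔞 : Ideal R} {l : List R} {N : ℕ} (hI : ∀ r ∈ l, r ∈ I)
    (hN : I ^ N ≤ 𝔞 ⊔ Ideal.ofList l) (hl : SeqHolds (RegMod M) 𝔞 l) :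
    SeqHolds (AsympRegMod M I) 𝔞 l := by
  induction l generalizing 𝔞 with
  | nil => trivial
  | cons z l ih =>
    refine ⟨.of_regMod hI hl hN, ih (fun r hr => hI r (List.mem_cons_of_mem _ hr)) ?_ hl.2⟩
    rwa [sup_assoc, ← Ideal.ofList_cons]

end Module

/-! ### Independence of the system of parameters -/

section Local

variable {R : Type*} [CommRing R] [IsLocalRing R] [IsNoetherianRing R]

theorem radical_sup_span_singleton_eq (𝔟 : Ideal R) {u : R}
    (hu : (𝔟 ⊔ Ideal.span {u}).radical = maximalIdeal R) {z : R} (hzm : z ∈ maximalIdeal R)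
    (h𝔟 : 𝔟 ≤ maximalIdeal R) (hz : ∀ p ∈ 𝔟.minimalPrimes, z ∈ p → p = maximalIdeal R) :
    (𝔟 ⊔ Ideal.span {z}).radical = maximalIdeal R := by
  have hmin : maximalIdeal R ∈ (Ideal.span (insert u (𝔟 : Set R))).minimalPrimes := by
    rw [Ideal.span_insert, Ideal.span_eq, sup_comm, ← Ideal.radical_minimalPrimes, hu,
      Ideal.minimalPrimes_eq_subsingleton_self]
    rfl
  refine le_antisymm ?_ ?_
  · exact (Ideal.IsPrime.radical_le_iff inferInstance).2
      (sup_le h𝔟 ((Ideal.span_singleton_le_iff_mem _).2 hzm))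
  · rw [Ideal.radical_eq_sInf]
    refine le_sInf ?_
    rintro q ⟨hq, hqp⟩
    by_contra hne
    have hlt : q < maximalIdeal R :=
      lt_of_le_of_ne (le_maximalIdeal hqp.ne_top) fun h => hne h.ge
    have hq𝔟 : q ∈ 𝔟.minimalPrimes := by
      have := Ideal.mem_minimalPrimes_span_of_mem_minimalPrimes_span_insert hlt u (𝔟 : Set R) hmin
        (𝔟 : Set R) (fun b hb => hq (Ideal.mem_sup_left hb)) fun b hb => Ideal.le_radical
          (Ideal.subset_span (Set.mem_insert_of_mem _ hb))
      rwa [Ideal.span_eq] at this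
    exact hlt.ne (hz q hq𝔟 (hq (Ideal.mem_sup_right (Ideal.mem_span_singleton_self z))))

theorem exists_common_parameter {𝔟 𝔠 : Ideal R} {u v : R}
    (hu : (𝔟 ⊔ Ideal.span {u}).radical = maximalIdeal R)
    (hv : (𝔠 ⊔ Ideal.span {v}).radical = maximalIdeal R)
    (h𝔟 : 𝔟.radical ≠ maximalIdeal R) (h𝔠 : 𝔠.radical ≠ maximalIdeal R) :
    ∃ z ∈ maximalIdeal R, (𝔟 ⊔ Ideal.span {z}).radical = maximalIdeal R ∧
      (𝔠 ⊔ Ideal.span {z}).radical = maximalIdeal R := by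
  have hle {𝔡 : Ideal R} {w : R} (hw : (𝔡 ⊔ Ideal.span {w}).radical = maximalIdeal R) :
      𝔡 ≤ maximalIdeal R := hw ▸ le_sup_left.trans Ideal.le_radical
  have hnot {𝔡 p : Ideal R} (hd : 𝔡.radical ≠ maximalIdeal R) (h𝔡 : 𝔡 ≤ maximalIdeal R)
      (hp : p ∈ 𝔡.minimalPrimes) : p ≠ maximalIdeal R := by
    rintro rfl
    refine hd (le_antisymm ((Ideal.IsPrime.radical_le_iff inferInstance).2 h𝔡) ?_)
    rw [Ideal.radical_eq_sInf]
    exact le_sInf fun q hq => hp.2 ⟨hq.2, hq.1⟩ (le_maximalIdeal hq.2.ne_top)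
  let s : Set (Ideal R) := 𝔟.minimalPrimes ∪ 𝔠.minimalPrimes
  have hs : s.Finite := (𝔟.finite_minimalPrimes_of_isNoetherianRing R).union
    (𝔠.finite_minimalPrimes_of_isNoetherianRing R)
  have hsp : ∀ p ∈ s, p.IsPrime ∧ p ≠ maximalIdeal R := by
    rintro p (hp | hp)
    · exact ⟨hp.isPrime, hnot h𝔟 (hle hu) hp⟩
    · exact ⟨hp.isPrime, hnot h𝔠 (hle hv) hp⟩
  obtain ⟨z, hzm, hz⟩ : ∃ z ∈ maximalIdeal R, ∀ p ∈ s, z ∉ p := by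
    by_contra! h
    obtain ⟨p, hp, hle⟩ := (Ideal.subset_union_prime_finite hs (f := id) ⊥ ⊥
      fun p hp _ _ => (hsp p hp).1).1 fun z hz => by simpa using h z hz
    exact (hsp p hp).2 (le_antisymm (le_maximalIdeal (hsp p hp).1.ne_top) hle)
  exact ⟨z, hzm,
    radical_sup_span_singleton_eq 𝔟 hu hzm (hle hu) fun p hp h => (hz p (.inl hp) h).elim,
    radical_sup_span_singleton_eq 𝔠 hv hzm (hle hv) fun p hp h => (hz p (.inr hp) h).elim⟩

/-- Asymptotic regularity of one system of parameters modulo `𝔞` implies that of any other. -/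
theorem SeqHolds.change_parameters {M : Type*} [AddCommGroup M] [Module R M] (d : ℕ)
    {𝔞 : Ideal R} {x y : List R} (hx : x.length = d) (hy : y.length = d)
    (hxm : ∀ r ∈ x, r ∈ maximalIdeal R) (hym : ∀ r ∈ y, r ∈ maximalIdeal R)
    (hxr : (𝔞 ⊔ Ideal.ofList x).radical = maximalIdeal R)
    (hyr : (𝔞 ⊔ Ideal.ofList y).radical = maximalIdeal R)
    (hd : ∀ l : List R, (𝔞 ⊔ Ideal.ofList l).radical = maximalIdeal R → d ≤ l.length)
    (h : SeqHolds (AsympRegMod M (maximalIdeal R)) 𝔞 x) :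
    SeqHolds (AsympRegMod M (maximalIdeal R)) 𝔞 y := by
  induction d generalizing 𝔞 x y with
  | zero =>
    rw [List.length_eq_zero_iff.1 hy]
    trivial
  | succ d ih =>
    obtain ⟨x, u, rfl⟩ : ∃ x' u, x = x' ++ [u] :=
      (List.eq_nil_or_concat' x).resolve_left (by rintro rfl; simp at hx)
    obtain ⟨y, v, rfl⟩ : ∃ y' v, y = y' ++ [v] :=
      (List.eq_nil_or_concat' y).resolve_left (by rintro rfl; simp at hy)
    simp only [List.length_append, List.length_singleton, Nat.add_right_cancel_iff] at hx hy
    rw [Ideal.ofList_append, Ideal.ofList_singleton, ← sup_assoc] at hxr hyr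
    obtain ⟨z, hzm, hxz, hyz⟩ := exists_common_parameter hxr hyr
      (fun e => by have := hd _ e; omega) (fun e => by have := hd _ e; omega)
    have hxm' : ∀ r ∈ x, r ∈ maximalIdeal R := fun r hr => hxm r (by simp [hr])
    have hym' : ∀ r ∈ y, r ∈ maximalIdeal R := fun r hr => hym r (by simp [hr])
    have replace_last {w : List R} {a b : R} (ha : a ∈ maximalIdeal R)
        (hb : (𝔞 ⊔ Ideal.ofList w ⊔ Ideal.span {b}).radical = maximalIdeal R)
        (hw : SeqHolds (AsympRegMod M (maximalIdeal R)) 𝔞 (w ++ [a])) :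
        SeqHolds (AsympRegMod M (maximalIdeal R)) 𝔞 (w ++ [b]) := by
      obtain ⟨h₁, h₂, -⟩ := seqHolds_append.1 hw
      rw [← hb] at ha
      obtain ⟨t, ht⟩ := ha
      exact seqHolds_append.2 ⟨h₁, h₂.of_pow_mem ht, trivial⟩
    have hxz' := replace_last (hxm u (by simp)) hxz h
    have hzx := hxz'.perm (List.perm_append_singleton z x)
      (by simpa [or_imp, forall_and] using ⟨hxm', hzm⟩)
    have hzy : SeqHolds (AsympRegMod M (maximalIdeal R)) 𝔞 (z :: y) := by
      refine ⟨hzx.1, ih hx hy hxm' hym' ?_ ?_ (fun l hl => ?_) hzx.2⟩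
      · rwa [sup_right_comm]
      · rwa [sup_right_comm]
      · have := hd (z :: l) (by rwa [Ideal.ofList_cons, ← sup_assoc])
        simpa using this
    have hyz' := hzy.perm (List.perm_append_singleton z y).symm
      (by simpa [or_imp, forall_and] using ⟨hzm, hym'⟩)
    exact replace_last hzm hyr hyz'

end Local

end SeedLimit

/-! ### Quotients of products -/

namespace SeedLimit

open Filter

section Product

variable {R : Type*} [CommRing R] {T : Type*} {B : T → Type*}

theorem pi_mem_smul_top [∀ t, AddCommGroup (B t)] [∀ t, Module R (B t)] {𝔞 : Ideal R} (h𝔞 : 𝔞.FG)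
    {a : ∀ t, B t} (ha : ∀ t, a t ∈ 𝔞 • (⊤ : Submodule R (B t))) :
    a ∈ 𝔞 • (⊤ : Submodule R (∀ t, B t)) := by
  induction 𝔞, h𝔞 using Submodule.fg_induction generalizing a with
  | singleton r =>
    have h (t) : ∃ c : B t, r • c = a t := by
      have := ha t
      rw [← Ideal.span, Submodule.ideal_span_singleton_smul,
        Submodule.mem_smul_pointwise_iff_exists] at this
      simpa using this
    choose c hc using h
    rw [← Ideal.span, Submodule.ideal_span_singleton_smul, Submodule.mem_smul_pointwise_iff_exists]
    exact ⟨c, trivial, funext hc⟩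
  | sup 𝔞 𝔟 _ _ h₁ h₂ =>
    simp only [Submodule.sup_smul, Submodule.mem_sup] at ha ⊢
    choose b hb c hc e using ha
    exact ⟨b, h₁ hb, c, h₂ hc, funext e⟩

theorem mk_mem_smul_top_iff [IsNoetherianRing R] [∀ t, CommRing (B t)] [∀ t, Algebra R (B t)]
    {𝔞 : Ideal R} {J : Ideal (∀ t, B t)} {b : ∀ t, B t} :
    Ideal.Quotient.mk J b ∈ 𝔞 • (⊤ : Submodule R ((∀ t, B t) ⧸ J)) ↔
      ∃ e ∈ J, ∀ t, b t - e t ∈ 𝔞 • (⊤ : Submodule R (B t)) := by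
  have h : 𝔞 • (⊤ : Submodule R ((∀ t, B t) ⧸ J)) =
      (𝔞 • (⊤ : Submodule R (∀ t, B t))).map (Ideal.Quotient.mkₐ R J).toLinearMap := by
    rw [Submodule.map_smul'', Submodule.map_top, LinearMap.range_eq_top.2]
    exact Ideal.Quotient.mkₐ_surjective R J
  rw [h, Submodule.mem_map]
  constructor
  · rintro ⟨a, ha, e⟩
    refine ⟨b - a, Ideal.Quotient.eq.1 e.symm, fun t => ?_⟩
    rw [Pi.sub_apply, sub_sub_cancel]
    have := Submodule.mem_map_of_mem (f := LinearMap.proj (R := R) (φ := B) t) ha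
    rw [Submodule.map_smul''] at this
    exact Submodule.smul_mono le_rfl le_top this
  · rintro ⟨e, he, h⟩
    refine ⟨b - e, pi_mem_smul_top (IsNoetherian.noetherian 𝔞) h, ?_⟩
    exact Ideal.Quotient.eq.2 (by simpa using neg_mem he)

end Product

section Sequence

variable {R : Type*} [CommRing R] (I : Ideal R) (B : Type*) [CommRing B] [Algebra R B]

/-- The sequences in `B` which converge to zero in the `I`-adic topology. -/
def nullSequences : Ideal (ℕ → B) where
  carrier := {b | ∀ k, ∀ᶠ n in atTop, b n ∈ (I ^ k).map (algebraMap R B)}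
  zero_mem' _ := .of_forall fun _ => zero_mem _
  add_mem' ha hb k := by
    filter_upwards [ha k, hb k] with n h₁ h₂ using add_mem h₁ h₂
  smul_mem' c _ hb k := by
    filter_upwards [hb k] with n h using Ideal.mul_mem_left _ _ h

variable {I B}

theorem mem_nullSequences {b : ℕ → B} : b ∈ nullSequences I B ↔
    ∀ k, ∀ᶠ n in atTop, b n ∈ I ^ k • (⊤ : Submodule R B) := by
  simp only [Ideal.smul_top_eq_map]
  rfl

theorem mk_nullSequences_mem_smul_top_iff [IsNoetherianRing R] {𝔞 : Ideal R} {b : ℕ → B} :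
    Ideal.Quotient.mk (nullSequences I B) b ∈
        𝔞 • (⊤ : Submodule R ((ℕ → B) ⧸ nullSequences I B)) ↔
      ∀ k, ∀ᶠ n in atTop, b n ∈ (𝔞 ⊔ I ^ k) • (⊤ : Submodule R B) := by
  classical
  rw [mk_mem_smul_top_iff (B := fun _ : ℕ => B)]
  constructor
  · rintro ⟨e, he, h⟩ k
    filter_upwards [mem_nullSequences.1 he k] with n hn
    rw [Submodule.sup_smul, ← sub_add_cancel (b n) (e n)]
    exact Submodule.add_mem_sup (h n) hn
  · intro h
    let P (n k : ℕ) : Prop := b n ∈ (𝔞 ⊔ I ^ k) • (⊤ : Submodule R B)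
    have hP (n : ℕ) : P n (Nat.findGreatest (P n) n) :=
      Nat.findGreatest_spec (Nat.zero_le n)
        (by
          change b n ∈ (𝔞 ⊔ I ^ 0) • (⊤ : Submodule R B)
          rw [pow_zero, Ideal.one_eq_top, sup_top_eq, Submodule.top_smul]
          trivial)
    have hdec (n : ℕ) : ∃ e ∈ I ^ (Nat.findGreatest (P n) n) • (⊤ : Submodule R B),
        b n - e ∈ 𝔞 • (⊤ : Submodule R B) := by
      have h := hP n
      generalize Nat.findGreatest (P n) n = k at h ⊢
      simp only [P, Submodule.sup_smul, Submodule.mem_sup] at h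
      obtain ⟨a, ha, e, he, hae⟩ := h
      exact ⟨e, he, by rwa [← hae, add_sub_cancel_right]⟩
    choose e he hbe using hdec
    refine ⟨e, mem_nullSequences.2 fun k => ?_, hbe⟩
    filter_upwards [h k, eventually_ge_atTop k] with n hn hkn
    exact mem_smul_top_of_le (Ideal.pow_le_pow_right (Nat.le_findGreatest hkn hn)) (he n)

theorem AsympRegMod.regMod_nullSequences [IsNoetherianRing R] {𝔞 : Ideal R} {r : R}
    (h : AsympRegMod B I 𝔞 r) : RegMod ((ℕ → B) ⧸ nullSequences I B) 𝔞 r := by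
  intro b hb
  obtain ⟨b, rfl⟩ := Ideal.Quotient.mk_surjective b
  have hb' : Ideal.Quotient.mk (nullSequences I B) (r • b) ∈
      𝔞 • (⊤ : Submodule R ((ℕ → B) ⧸ nullSequences I B)) := hb
  rw [mk_nullSequences_mem_smul_top_iff] at hb' ⊢
  intro k
  obtain ⟨m, hm⟩ := h k
  filter_upwards [hb' m] with n hn using hm _ hn

end Sequence

section Reduced

variable {R : Type*} [CommRing R] {T : Type*} (F : Filter T) (B : T → Type*)
  [∀ t, CommRing (B t)] [∀ t, Algebra R (B t)]

/-- The ideal of families which vanish eventually along a filter. -/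
def eventuallyZero : Ideal (∀ t, B t) where
  carrier := {b | ∀ᶠ t in F, b t = 0}
  zero_mem' := .of_forall fun _ => rfl
  add_mem' ha hb := by
    filter_upwards [ha, hb] with t h₁ h₂
    rw [Pi.add_apply, h₁, h₂, add_zero]
  smul_mem' c _ hb := by
    filter_upwards [hb] with t h
    rw [Pi.smul_apply', h, smul_zero]

variable {F B}

theorem mk_eventuallyZero_mem_smul_top_iff [IsNoetherianRing R] {𝔞 : Ideal R} {b : ∀ t, B t} :
    Ideal.Quotient.mk (eventuallyZero F B) b ∈
        𝔞 • (⊤ : Submodule R ((∀ t, B t) ⧸ eventuallyZero F B)) ↔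
      ∀ᶠ t in F, b t ∈ 𝔞 • (⊤ : Submodule R (B t)) := by
  classical
  rw [mk_mem_smul_top_iff]
  constructor
  · rintro ⟨e, he, h⟩
    filter_upwards [show ∀ᶠ t in F, e t = 0 from he] with t ht
    simpa [ht] using h t
  · intro h
    refine ⟨fun t => if b t ∈ 𝔞 • (⊤ : Submodule R (B t)) then 0 else b t, ?_, fun t => ?_⟩
    · filter_upwards [h] with t ht using if_pos ht
    · beta_reduce
      split_ifs with ht
      · rwa [sub_zero]
      · rw [sub_self]
        exact zero_mem _

theorem RegMod.eventuallyZero [IsNoetherianRing R] {𝔞 : Ideal R} {r : R}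
    (h : ∀ t, RegMod (B t) 𝔞 r) : RegMod ((∀ t, B t) ⧸ eventuallyZero F B) 𝔞 r := by
  intro b hb
  obtain ⟨b, rfl⟩ := Ideal.Quotient.mk_surjective b
  have hb' : Ideal.Quotient.mk (SeedLimit.eventuallyZero F B) (r • b) ∈
      𝔞 • (⊤ : Submodule R ((∀ t, B t) ⧸ SeedLimit.eventuallyZero F B)) := hb
  rw [mk_eventuallyZero_mem_smul_top_iff] at hb' ⊢
  filter_upwards [hb'] with t ht using h t _ ht

end Reduced

/-! ### Big Cohen-Macaulay algebras -/

theorem ofList_ofFn {R : Type*} [CommRing R] {n : ℕ} (x : Fin n → R) :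
    Ideal.ofList (List.ofFn x) = Ideal.span (Set.range x) := by
  rw [Ideal.ofList]
  congr 1
  ext r
  simp [List.mem_ofFn]

section BigCM

variable {R : Type*} [CommRing R] [IsLocalRing R]

theorem map_maximalIdeal_ne_top_iff {B : Type*} [CommRing B] [Algebra R B] :
    (maximalIdeal R).map (algebraMap R B) ≠ ⊤ ↔
      (1 : B) ∉ maximalIdeal R • (⊤ : Submodule R B) := by
  rw [Ideal.ne_top_iff_one, Ideal.smul_top_eq_map]
  rfl

theorem isRegSeq_iff {B : Type*} [CommRing B] [Algebra R B] {n : ℕ} {x : Fin n → R}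
    (hx : IsSOP R x) (hB : (maximalIdeal R).map (algebraMap R B) ≠ ⊤) :
    IsRegSeq R B x ↔ SeqHolds (RegMod B) ⊥ (List.ofFn x) := by
  rw [IsRegSeq, RingTheory.Sequence.isRegular_iff, isWeaklyRegular_iff_seqHolds,
    and_iff_left_iff_imp]
  intro _ h
  refine map_maximalIdeal_ne_top_iff.1 hB (mem_smul_top_of_le ?_ (h ▸ Submodule.mem_top))
  rw [ofList_ofFn, ← hx.2.2]
  exact Ideal.le_radical

variable [IsNoetherianRing R]

theorem le_length_of_radical_eq {n : ℕ} (hn : (n : WithBot ℕ∞) = ringKrullDim R) {l : List R}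
    (hl : (Ideal.ofList l).radical = maximalIdeal R) : n ≤ l.length := by
  classical
  have hmin : maximalIdeal R ∈ (Ideal.span (l.toFinset : Set R)).minimalPrimes := by
    rw [← Ideal.radical_minimalPrimes]
    have : Ideal.span (l.toFinset : Set R) = Ideal.ofList l := by
      rw [List.coe_toFinset]
    rw [this, hl, Ideal.minimalPrimes_eq_subsingleton_self]
    rfl
  have h := Ideal.height_le_card_of_mem_minimalPrimes_span_finset hmin
  have h' : (n : WithBot ℕ∞) ≤ ((l.toFinset.card : ℕ∞) : WithBot ℕ∞) := by
    rw [hn, ← IsLocalRing.maximalIdeal_height_eq_ringKrullDim]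
    exact_mod_cast h
  exact (by exact_mod_cast h' : n ≤ l.toFinset.card).trans l.toFinset_card_le

/-- A big Cohen-Macaulay algebra maps to one on which a prescribed system of parameters is a
regular sequence. -/
theorem exists_isRegSeq_of_isBigCM.{a} {B : Type a} [CommRing B] [Algebra R B] (hB : IsBigCM R B)
    {n : ℕ} {y : Fin n → R} (hy : IsSOP R y) :
    ∃ (C : Type a) (_ : CommRing C) (_ : Algebra R C), IsRegSeq R C y ∧
      (maximalIdeal R).map (algebraMap R C) ≠ ⊤ ∧ Nonempty (B →ₐ[R] C) := by
  obtain ⟨⟨n', x, hx, hreg⟩, htop⟩ := hB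
  obtain rfl : n' = n := by exact_mod_cast hx.1.trans hy.1.symm
  have mem {z : Fin n' → R} (hz : IsSOP R z) : ∀ r ∈ List.ofFn z, r ∈ maximalIdeal R := by
    intro r hr
    obtain ⟨i, rfl⟩ := List.mem_ofFn.1 hr
    exact hz.2.1 i
  have rad {z : Fin n' → R} (hz : IsSOP R z) :
      (⊥ ⊔ Ideal.ofList (List.ofFn z)).radical = maximalIdeal R := by
    rw [bot_sup_eq, ofList_ofFn, hz.2.2]
  obtain ⟨N, hN⟩ := Ideal.exists_pow_le_of_le_radical_of_fg (rad hx).ge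
    (IsNoetherian.noetherian _)
  have hreg' := ((isRegSeq_iff hx htop).1 hreg).asympRegMod (mem hx) hN
  have hreg'' := hreg'.change_parameters n' (by simp) (by simp) (mem hx) (mem hy) (rad hx) (rad hy)
    fun l hl => le_length_of_radical_eq hx.1 (by rwa [bot_sup_eq] at hl)
  have htop' : (maximalIdeal R).map (algebraMap R
      ((ℕ → B) ⧸ nullSequences (maximalIdeal R) B)) ≠ ⊤ := by
    rw [map_maximalIdeal_ne_top_iff] at htop ⊢
    rw [← map_one (Ideal.Quotient.mk _), mk_nullSequences_mem_smul_top_iff]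
    intro h
    obtain ⟨k, hk⟩ := (h 1).exists
    exact htop (by simpa using hk)
  exact ⟨_, _, _, (isRegSeq_iff hy htop').2 (hreg''.imp fun _ _ h => h.regMod_nullSequences), htop',
    ⟨(Ideal.Quotient.mkₐ R _).comp (Pi.constAlgHom R ℕ B)⟩⟩

theorem isBigCM_quotient_eventuallyZero {T : Type*} {F : Filter T} [F.NeBot] {B : T → Type*}
    [∀ t, CommRing (B t)] [∀ t, Algebra R (B t)] {n : ℕ} {y : Fin n → R} (hy : IsSOP R y)
    (hreg : ∀ t, IsRegSeq R (B t) y)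
    (htop : ∀ t, (maximalIdeal R).map (algebraMap R (B t)) ≠ ⊤) :
    IsBigCM R ((∀ t, B t) ⧸ eventuallyZero F B) := by
  have htop' : (maximalIdeal R).map (algebraMap R ((∀ t, B t) ⧸ eventuallyZero F B)) ≠ ⊤ := by
    rw [map_maximalIdeal_ne_top_iff, ← map_one (Ideal.Quotient.mk _),
      mk_eventuallyZero_mem_smul_top_iff]
    intro h
    obtain ⟨t, ht⟩ := h.exists
    exact map_maximalIdeal_ne_top_iff.1 (htop t) ht
  refine ⟨⟨n, y, hy, (isRegSeq_iff hy htop').2 (seqHolds_iff.2 fun i hi => ?_)⟩, htop'⟩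
  exact RegMod.eventuallyZero fun t =>
    seqHolds_iff.1 ((isRegSeq_iff hy (htop t)).1 (hreg t)) i hi

end BigCM

/-! ### Finitely many relations in a direct limit -/

theorem exists_lift_of_finset_relations {R : Type*} [CommRing R] {ι : Type*} [Preorder ι]
    [IsDirected ι (· ≤ ·)] [Nonempty ι] {Sfam : ι → Type*} [∀ i, CommRing (Sfam i)]
    [∀ i, Algebra R (Sfam i)] (f : ∀ i j, i ≤ j → Sfam i →ₐ[R] Sfam j)
    (hf_comp : ∀ i j k (hij : i ≤ j) (hjk : j ≤ k) (x : Sfam i),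
      f j k hjk (f i j hij x) = f i k (le_trans hij hjk) x)
    {S : Type*} [CommRing S] [Algebra R S] (g : ∀ i, Sfam i →ₐ[R] S)
    (hg : ∀ i j (hij : i ≤ j) (x : Sfam i), g j (f i j hij x) = g i x)
    (hsurj : ∀ s : S, ∃ (i : ι) (x : Sfam i), g i x = s)
    (hker : ∀ i (x : Sfam i), g i x = 0 → ∃ j, ∃ hij : i ≤ j, f i j hij x = 0)
    (t : Finset (MvPolynomial S R)) (ht : ∀ p ∈ t, MvPolynomial.aeval id p = (0 : S)) :
    ∃ (i : ι) (φ : S → Sfam i), ∀ p ∈ t, MvPolynomial.aeval φ p = 0 := by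
  classical
  choose idx lift hlift using hsurj
  obtain ⟨i, hi⟩ := ((t.biUnion MvPolynomial.vars).image idx).exists_le
  let φ (s : S) : Sfam i := if h : idx s ≤ i then f _ _ h (lift s) else 0
  have hφ (p) (hp : p ∈ t) : g i (MvPolynomial.aeval φ p) = 0 := by
    rw [← ht p hp, ← AlgHom.comp_apply, MvPolynomial.comp_aeval, MvPolynomial.aeval_def,
      MvPolynomial.aeval_def]
    refine MvPolynomial.eval₂Hom_congr' rfl (fun s hs _ => ?_) rfl
    have hsi : idx s ≤ i :=
      hi _ (Finset.mem_image_of_mem _ (Finset.mem_biUnion.2 ⟨p, hp, hs⟩))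
    simp [φ, hsi, hg, hlift]
  have hkill (p : t) : ∃ j, ∃ hij : i ≤ j, f i j hij (MvPolynomial.aeval φ p.1) = 0 :=
    hker _ _ (hφ p.1 p.2)
  choose j hij hj using hkill
  obtain ⟨k, hk⟩ := (insert i (Finset.univ.image j)).exists_le
  have hik : i ≤ k := hk i (Finset.mem_insert_self _ _)
  refine ⟨k, fun s => f i k hik (φ s), fun p hp => ?_⟩
  have hjk : j ⟨p, hp⟩ ≤ k := hk _ (by simp)
  have e : MvPolynomial.aeval (fun s => f i k hik (φ s)) p =
      f i k hik (MvPolynomial.aeval φ p) := by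
    rw [← AlgHom.comp_apply, MvPolynomial.comp_aeval]
  rw [e, ← hf_comp i _ k (hij ⟨p, hp⟩) hjk, hj ⟨p, hp⟩, map_zero]

end SeedLimit

/-- **Lemma (Dietz, Lem. 3.2 / `limit`).** Let `(R,m)` be a Noetherian local ring and let
`S` be the direct limit of a directed system of `R`-algebras `Sfam` (presented by compatible
maps `g i : Sfam i →ₐ[R] S` which are jointly surjective and whose kernels are eventually
killed in the system). Then `S` is a seed over `R` iff every `Sfam i` is a seed over `R`. -/
theorem direct_limit_seed_iff
    (R : Type u) [CommRing R] [IsLocalRing R] [IsNoetherianRing R]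
    (ι : Type v) [Preorder ι] [IsDirected ι (· ≤ ·)] [Nonempty ι]
    (Sfam : ι → Type w) [∀ i, CommRing (Sfam i)] [∀ i, Algebra R (Sfam i)]
    (f : ∀ i j, i ≤ j → Sfam i →ₐ[R] Sfam j)
    (hf_id : ∀ i (x : Sfam i), f i i le_rfl x = x)
    (hf_comp : ∀ i j k (hij : i ≤ j) (hjk : j ≤ k) (x : Sfam i),
      f j k hjk (f i j hij x) = f i k (le_trans hij hjk) x)
    (S : Type w) [CommRing S] [Algebra R S]
    (g : ∀ i, Sfam i →ₐ[R] S)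
    (hg : ∀ i j (hij : i ≤ j) (x : Sfam i), g j (f i j hij x) = g i x)
    (hsurj : ∀ s : S, ∃ (i : ι) (x : Sfam i), g i x = s)
    (hker : ∀ i (x : Sfam i), g i x = 0 → ∃ j, ∃ hij : i ≤ j, f i j hij x = 0) :
    IsSeed R S ↔ ∀ i, IsSeed R (Sfam i) := by
  constructor
  · rintro ⟨B, _, _, hB, ⟨h⟩⟩ i
    exact ⟨B, _, _, hB, ⟨h.comp (g i)⟩⟩
  · intro h
    obtain ⟨n, y, hy⟩ : ∃ (n : ℕ) (y : Fin n → R), IsSOP R y := by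
      obtain ⟨B, _, _, ⟨⟨n, y, hy, -⟩, -⟩, -⟩ := h (Classical.arbitrary ι)
      exact ⟨n, y, hy⟩
    have hC (i : ι) : ∃ (C : Type (max u w)) (_ : CommRing C) (_ : Algebra R C),
        IsRegSeq R C y ∧ (maximalIdeal R).map (algebraMap R C) ≠ ⊤ ∧
          Nonempty (Sfam i →ₐ[R] C) := by
      obtain ⟨B, _, _, hB, ⟨e⟩⟩ := h i
      obtain ⟨C, _, _, hreg, htop, ⟨e'⟩⟩ := SeedLimit.exists_isRegSeq_of_isBigCM hB hy
      exact ⟨C, _, _, hreg, htop, ⟨e'.comp e⟩⟩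
    choose C _ _ hreg htop e using hC
    let π : MvPolynomial S R →ₐ[R] S := MvPolynomial.aeval id
    let T := Finset (RingHom.ker π)
    have hT (t : T) : ∃ (i : ι) (φ : S → Sfam i), ∀ p ∈ t, MvPolynomial.aeval φ p.1 = 0 := by
      classical
      obtain ⟨i, φ, hφ⟩ := SeedLimit.exists_lift_of_finset_relations f hf_comp g hg hsurj hker
        (t.image Subtype.val) (by
          intro p hp
          obtain ⟨q, -, rfl⟩ := Finset.mem_image.1 hp
          exact q.2)
      exact ⟨i, φ, fun p hp => hφ _ (Finset.mem_image_of_mem _ hp)⟩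
    choose i φ hφ using hT
    let J := SeedLimit.eventuallyZero (Filter.atTop : Filter T) (fun t => C (i t))
    let Ψ : MvPolynomial S R →ₐ[R] (∀ t, C (i t)) ⧸ J := (Ideal.Quotient.mkₐ R J).comp
      (AlgHom.pi fun t => (e (i t)).some.comp (MvPolynomial.aeval (φ t)))
    have hΨ : RingHom.ker π.toRingHom ≤ RingHom.ker Ψ.toRingHom := by
      intro p hp
      refine Ideal.Quotient.eq_zero_iff_mem.2 ?_
      filter_upwards [Filter.eventually_ge_atTop ({⟨p, hp⟩} : T)] with t ht
      have : MvPolynomial.aeval (φ t) p = 0 := hφ t ⟨p, hp⟩ (ht (Finset.mem_singleton_self _))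
      simp [this]
    exact ⟨_, _, _, SeedLimit.isBigCM_quotient_eventuallyZero hy (fun t => hreg (i t))
      (fun t => htop (i t)),
      ⟨AlgHom.liftOfSurjective π (fun s => ⟨MvPolynomial.X s, by simp [π]⟩) Ψ hΨ⟩⟩
end

section
/- Let (R,m) be a Noetherian local ring, let B be a balanced big Cohen-Macaulay R-algebra, and let 𝔭 be a prime ideal of B containing mB. Then the localization B_𝔭 is a balanced big Cohen-Macaulay R-algebra. Moreover, if B is reduced then B_𝔭 is reduced, and if in addition R has positive prime characteristic p and B is reduced and perfect (Frobenius on B is bijective), then B_𝔭 is reduced and perfect. -/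
open IsLocalRing

universe u v w

/-- The maximal ideal of `R` extends to a proper ideal in the localization of an `R`-algebra `B` at
a prime ideal containing the extension of the maximal ideal. -/
theorem map_maximalIdeal_ne_top_of_isLocalization_atPrime {R B S : Type*} [CommRing R]
    [IsLocalRing R] [CommRing B] [Algebra R B] [CommRing S] [Algebra B S] [Algebra R S]
    [IsScalarTower R B S] (𝔭 : Ideal B) [𝔭.IsPrime] [IsLocalization.AtPrime S 𝔭]
    (h𝔭 : (maximalIdeal R).map (algebraMap R B) ≤ 𝔭) :
    (maximalIdeal R).map (algebraMap R S) ≠ ⊤ := by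
  have : IsLocalRing S := IsLocalization.AtPrime.isLocalRing S 𝔭
  have hle : (maximalIdeal R).map (algebraMap R S) ≤ maximalIdeal S := by
    rw [IsScalarTower.algebraMap_eq R B S, ← Ideal.map_map,
      ← IsLocalization.AtPrime.map_eq_maximalIdeal 𝔭 S]
    exact Ideal.map_mono h𝔭
  exact ne_top_of_le_ne_top (maximalIdeal.isMaximal S).ne_top hle

/-- The localization of a balanced big Cohen-Macaulay algebra at a prime ideal containing the
extension of the maximal ideal is a balanced big Cohen-Macaulay algebra. -/
theorem IsBalancedBigCM.of_isLocalization_atPrime {R B S : Type*} [CommRing R]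
    [IsLocalRing R] [CommRing B] [Algebra R B] [CommRing S] [Algebra B S] [Algebra R S]
    [IsScalarTower R B S] (𝔭 : Ideal B) [𝔭.IsPrime] [IsLocalization.AtPrime S 𝔭]
    (h𝔭 : (maximalIdeal R).map (algebraMap R B) ≤ 𝔭) (hB : IsBalancedBigCM R B) :
    IsBalancedBigCM R S := by
  have hne := map_maximalIdeal_ne_top_of_isLocalization_atPrime (S := S) 𝔭 h𝔭
  refine ⟨fun n x hx => ⟨?_, fun htop => hne ?_⟩, hne⟩
  · have hreg := (RingTheory.Sequence.isWeaklyRegular_map_algebraMap_iff (S := B) (M := B) _).mpr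
      (hB.1 n x hx).toIsWeaklyRegular
    have hreg := hreg.of_isLocalization S 𝔭.primeCompl
    rwa [RingTheory.Sequence.isWeaklyRegular_map_algebraMap_iff,
      RingTheory.Sequence.isWeaklyRegular_map_algebraMap_iff] at hreg
  · have hle : Ideal.ofList (List.ofFn x) ≤ maximalIdeal R :=
      Ideal.span_le.mpr fun r hr => by
        obtain ⟨i, rfl⟩ := List.mem_ofFn.mp hr
        exact hx.2.1 i
    rw [Ideal.smul_top_eq_map, eq_comm, Submodule.restrictScalars_eq_top_iff] at htop
    exact top_le_iff.mp (htop ▸ Ideal.map_mono hle)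

/-- If the `p`-th power map is bijective on a commutative ring, it is bijective on the localization
at any submonoid closed under taking `p`-th roots. -/
theorem IsLocalization.bijective_pow {B S : Type*} [CommRing B] [CommRing S] [Algebra B S]
    (M : Submonoid B) [IsLocalization M S] {p : ℕ} (hp : p ≠ 0)
    (hM : ∀ b : B, b ^ p ∈ M → b ∈ M) (h : Function.Bijective (fun b : B => b ^ p)) :
    Function.Bijective (fun y : S => y ^ p) := by
  constructor
  · intro y z hyz
    obtain ⟨a, s, rfl⟩ := IsLocalization.exists_mk'_eq M y
    obtain ⟨b, t, rfl⟩ := IsLocalization.exists_mk'_eq M z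
    simp only [← IsLocalization.mk'_pow] at hyz
    obtain ⟨u, hu⟩ := IsLocalization.eq.mp hyz
    refine IsLocalization.eq.mpr ⟨u, h.1 ?_⟩
    obtain ⟨k, rfl⟩ := Nat.exists_eq_succ_of_ne_zero hp
    simp only [SubmonoidClass.coe_pow, Nat.succ_eq_add_one] at hu ⊢
    calc _ = (u : B) ^ k * (u * ((t : B) ^ (k + 1) * a ^ (k + 1))) := by ring
      _ = (u : B) ^ k * (u * ((s : B) ^ (k + 1) * b ^ (k + 1))) := by rw [hu]
      _ = _ := by ring
  · intro y
    obtain ⟨a, s, rfl⟩ := IsLocalization.exists_mk'_eq M y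
    obtain ⟨c, rfl⟩ := h.2 a
    obtain ⟨t, (ht : t ^ p = s)⟩ := h.2 s
    refine ⟨IsLocalization.mk' S c ⟨t, hM t (ht ▸ s.2)⟩, ?_⟩
    simp only [← IsLocalization.mk'_pow]
    congr 1
    exact Subtype.ext ht

/-- **Lemma (Dietz, Lem. 3.4 / `local`).** Let `(R,m)` be a Noetherian local ring, `B` a
balanced big Cohen-Macaulay `R`-algebra, and `𝔭` a prime ideal of `B` containing `mB`.
Then `B_𝔭` is a balanced big Cohen-Macaulay `R`-algebra; moreover if `B` is reduced then
so is `B_𝔭`, and if furthermore `R` has prime characteristic `p` and `B` is reduced and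
perfect, then `B_𝔭` is reduced and perfect. -/
theorem localization_balanced_bigCM
    (R : Type u) [CommRing R] [IsLocalRing R] [IsNoetherianRing R]
    (B : Type v) [CommRing B] [Algebra R B]
    (𝔭 : Ideal B) [𝔭.IsPrime] (h𝔭 : (maximalIdeal R).map (algebraMap R B) ≤ 𝔭)
    (hB : IsBalancedBigCM R B) :
    letI : Algebra R (Localization.AtPrime 𝔭) :=
      ((algebraMap B (Localization.AtPrime 𝔭)).comp (algebraMap R B)).toAlgebra
    IsBalancedBigCM R (Localization.AtPrime 𝔭) ∧
    (IsReduced B → IsReduced (Localization.AtPrime 𝔭)) ∧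
    (∀ p : ℕ, p.Prime → CharP R p → IsReduced B →
      Function.Bijective (fun b : B => b ^ p) →
      IsReduced (Localization.AtPrime 𝔭) ∧
        Function.Bijective (fun y : Localization.AtPrime 𝔭 => y ^ p)) := by
  let alg : Algebra R (Localization.AtPrime 𝔭) :=
    ((algebraMap B (Localization.AtPrime 𝔭)).comp (algebraMap R B)).toAlgebra
  have hloc : IsBalancedBigCM R (Localization.AtPrime 𝔭) :=
    @IsBalancedBigCM.of_isLocalization_atPrime R B _ _ _ _ _ _ _ alg
      (.of_algebraMap_eq fun _ => rfl) 𝔭 _ _ h𝔭 hB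
  have hred : IsReduced B → IsReduced (Localization.AtPrime 𝔭) := fun h =>
    isReduced_localizationPreserves 𝔭.primeCompl _ h
  exact ⟨hloc, hred, fun p hp _ h hbij => ⟨hred h,
    IsLocalization.bijective_pow 𝔭.primeCompl hp.ne_zero
      (fun b hb hmem => hb (𝔭.pow_mem_of_mem hmem p hp.pos)) hbij⟩⟩
end

section
/- Let (R,m) be a Noetherian local ring and let S be a seed over R. If S is an integral domain (respectively, a reduced ring), then there is an R-algebra homomorphism from S to a balanced big Cohen-Macaulay R-algebra that is an integral domain (respectively, a reduced ring). -/
open IsLocalRing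

universe u v w

open scoped Pointwise
open RingTheory.Sequence

section DerivedComplete

variable {A : Type*} [CommRing A] {K N P Q : Type*} [AddCommGroup K] [Module A K]
  [AddCommGroup N] [Module A N] [AddCommGroup P] [Module A P] [AddCommGroup Q] [Module A Q]

/-- `N` is derived complete with respect to `a`: every system of equations
`b n - a • b (n + 1) = c n` has exactly one solution in `N`. -/
def IsDerivedComplete (a : A) (N : Type*) [AddCommGroup N] [Module A N] : Prop :=
  Function.Bijective fun (b : ℕ → N) (n : ℕ) => b n - a • b (n + 1)

namespace IsDerivedComplete

lemma eq_zero {a : A} (h : IsDerivedComplete a N) {b : ℕ → N}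
    (hb : ∀ n, b n = a • b (n + 1)) (n : ℕ) : b n = 0 := by
  have : b = 0 := h.1 (funext fun n => by simp [← hb n])
  simp [this]

lemma exists_eq {a : A} (h : IsDerivedComplete a N) (c : ℕ → N) :
    ∃ b : ℕ → N, ∀ n, b n - a • b (n + 1) = c n :=
  let ⟨b, hb⟩ := h.2 c
  ⟨b, congrFun hb⟩

lemma mk' {a : A} (h₁ : ∀ b : ℕ → N, (∀ n, b n = a • b (n + 1)) → ∀ n, b n = 0)
    (h₂ : ∀ c : ℕ → N, ∃ b : ℕ → N, ∀ n, b n - a • b (n + 1) = c n) :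
    IsDerivedComplete a N := by
  refine ⟨fun b b' hbb' => ?_, fun c => (h₂ c).imp fun b hb => funext hb⟩
  funext n
  refine sub_eq_zero.mp (h₁ (fun n => b n - b' n) (fun n => ?_) n)
  have := congrFun hbb' n
  simp only at this
  rw [smul_sub, sub_eq_sub_iff_sub_eq_sub, this]

lemma subsingleton {a : A} (h : IsDerivedComplete a N) (hN : ∀ x : N, ∃ y, x = a • y) :
    Subsingleton N := by
  choose f hf using hN
  refine subsingleton_of_forall_eq 0 fun x => ?_
  exact h.eq_zero (b := fun n => f^[n] x)
    (fun n => by rw [Function.iterate_succ_apply']; exact hf _) 0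

/-- Derived completeness passes to kernels. -/
lemma of_injective {a : A} (hN : IsDerivedComplete a N) (hP : IsDerivedComplete a P)
    (i : K →ₗ[A] N) (g : N →ₗ[A] P) (hi : Function.Injective i)
    (hig : Function.Exact i g) : IsDerivedComplete a K := by
  refine mk' (fun b hb n => hi ?_) fun c => ?_
  · rw [map_zero]
    exact hN.eq_zero (b := fun n => i (b n)) (fun n => by rw [← map_smul, ← hb]) n
  · obtain ⟨b, hb⟩ := hN.exists_eq fun n => i (c n)
    have hgb : ∀ n, g (b n) = 0 := hP.eq_zero fun n => by
      rw [← map_smul, ← sub_eq_zero, ← map_sub, hb]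
      exact hig.apply_apply_eq_zero _
    choose b' hb' using fun n => (hig (b n)).mp (hgb n)
    exact ⟨b', fun n => hi <| by rw [map_sub, map_smul, hb', hb', hb]⟩

/-- Derived completeness passes to cokernels. -/
lemma of_surjective {a : A} (hN : IsDerivedComplete a N) (hP : IsDerivedComplete a P)
    (g : N →ₗ[A] P) (p : P →ₗ[A] Q) (hp : Function.Surjective p)
    (hgp : Function.Exact g p) : IsDerivedComplete a Q := by
  refine mk' (fun b hb n => ?_) fun c => ?_
  · choose b' hb' using fun n => hp (b n)
    choose c hc using fun n => (hgp (b' n - a • b' (n + 1))).mp <| by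
      rw [map_sub, map_smul, hb', hb', ← hb, sub_self]
    obtain ⟨d, hd⟩ := hN.exists_eq c
    have := hP.eq_zero (b := fun n => b' n - g (d n)) (fun n => by
      rw [smul_sub, sub_eq_sub_iff_sub_eq_sub, ← hc, ← hd, map_sub, map_smul]) n
    rw [← hb', sub_eq_zero.mp this]
    exact hgp.apply_apply_eq_zero _
  · choose c' hc' using fun n => hp (c n)
    obtain ⟨b, hb⟩ := hP.exists_eq c'
    exact ⟨fun n => p (b n), fun n => by rw [← map_smul, ← map_sub, hb, hc']⟩

lemma of_linearEquiv {a : A} (hN : IsDerivedComplete a N) (e : N ≃ₗ[A] P) :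
    IsDerivedComplete a P :=
  of_surjective hN hN (0 : N →ₗ[A] N) e.toLinearMap e.surjective fun x => by
    simpa using eq_comm

lemma pi {ι : Type*} {a : A} (hN : IsDerivedComplete a N) : IsDerivedComplete a (ι → N) := by
  refine mk' (fun b hb n => funext fun i => ?_) fun c => ?_
  · exact hN.eq_zero (b := fun n => b n i) (fun n => by rw [hb]; rfl) n
  · choose b hb using fun i => hN.exists_eq fun n => c n i
    exact ⟨fun n i => b i n, fun n => funext fun i => hb i n⟩

lemma quotSMulTop {a : A} (hN : IsDerivedComplete a N) (r : A) :
    IsDerivedComplete a (QuotSMulTop r N) :=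
  of_surjective hN hN (LinearMap.lsmul A N r) (Submodule.mkQ _) (Submodule.mkQ_surjective _)
    fun x => by simp [Submodule.mem_smul_pointwise_iff_exists]

lemma quot_ofList {a : A} (hN : IsDerivedComplete a N) (l : List A) :
    IsDerivedComplete a (N ⧸ (Ideal.ofList l • ⊤ : Submodule A N)) := by
  induction l generalizing N with
  | nil => exact hN.of_linearEquiv (Submodule.quotEquivOfEqBot _ (by simp)).symm
  | cons r l ih =>
    exact (ih (hN.quotSMulTop r)).of_linearEquiv
      (Submodule.quotOfListConsSMulTopEquivQuotSMulTopInner N r l).symm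

lemma torsionBy {a : A} (hN : IsDerivedComplete a N) (r : A) :
    IsDerivedComplete a (Submodule.torsionBy A N r) :=
  of_injective hN hN (Submodule.torsionBy A N r).subtype (LinearMap.lsmul A N r)
    (Submodule.injective_subtype _) fun x => by simp

/-- Nakayama's lemma for derived complete modules. -/
lemma subsingleton_of_ofList_smul_top_eq_top (l : List A)
    (hN : ∀ a ∈ l, IsDerivedComplete a N)
    (h : (Ideal.ofList l • ⊤ : Submodule A N) = ⊤) : Subsingleton N := by
  induction l generalizing N with
  | nil =>
    rw [Ideal.ofList_nil, Submodule.bot_smul] at h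
    exact (Submodule.subsingleton_iff A).mp (subsingleton_of_bot_eq_top h)
  | cons a l ih =>
    have := ih (N := QuotSMulTop a N)
      (fun b hb => (hN b (List.mem_cons_of_mem _ hb)).quotSMulTop a)
      ((Submodule.top_eq_ofList_cons_smul_iff a l).mp h.symm).symm
    refine (hN a List.mem_cons_self).subsingleton fun x => ?_
    have hx := (Submodule.Quotient.mk_eq_zero (a • ⊤ : Submodule A N) (x := x)).mp
      (Subsingleton.elim _ _)
    obtain ⟨y, -, hy⟩ := (Submodule.mem_smul_pointwise_iff_exists _ _ _).mp hx
    exact ⟨y, hy.symm⟩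

end IsDerivedComplete

/-- Weakly regular sequences with entries in the radical of `(l)` can be permuted if the module is
derived complete with respect to every element of `l`. -/
lemma RingTheory.Sequence.IsWeaklyRegular.perm_of_isDerivedComplete {l rs rs' : List A}
    (hl : ∀ a ∈ l, IsDerivedComplete a N) (hrs : ∀ r ∈ rs, r ∈ (Ideal.ofList l).radical)
    (h : IsWeaklyRegular N rs) (hp : rs.Perm rs') : IsWeaklyRegular N rs' := by
  refine h.prototype_perm hp fun a b l' hsub => ?_
  intro K hK
  obtain ⟨n, hn⟩ := hrs a (hsub.subset List.mem_cons_self)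
  have hpow : ∀ n : ℕ, K = a ^ n • K := fun n => by
    induction n with
    | zero => simp
    | succ n ih => rw [pow_succ', mul_smul, ← ih, ← hK]
  have hsurj : ∀ x : K, ∃ y : K, x = a ^ n • y := fun x => by
    have hx : x.1 ∈ a ^ n • K := hpow n ▸ x.2
    obtain ⟨y, hy, hyx⟩ := (Submodule.mem_smul_pointwise_iff_exists _ _ _).mp hx
    exact ⟨⟨y, hy⟩, Subtype.ext hyx.symm⟩
  have : Subsingleton K :=
    IsDerivedComplete.subsingleton_of_ofList_smul_top_eq_top l
      (fun c hc => ((hl c hc).quot_ofList l').torsionBy b) <| by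
      refine top_le_iff.mp fun x _ => ?_
      obtain ⟨y, rfl⟩ := hsurj x
      exact Submodule.smul_mem_smul hn trivial
  exact Submodule.subsingleton_iff_eq_bot.mp this

lemma RingTheory.Sequence.IsWeaklyRegular.swap_of_isDerivedComplete {a b : A} {rs : List A}
    (ha : IsDerivedComplete a N) (h : IsWeaklyRegular N (a :: b :: rs)) :
    IsWeaklyRegular N (b :: a :: rs) := by
  have h' := (isWeaklyRegular_append_iff N [a, b] rs).mp h
  refine (isWeaklyRegular_append_iff N [b, a] rs).mpr ⟨?_, ?_⟩
  · have hab := h'.1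
    simp only [isWeaklyRegular_cons_iff, IsWeaklyRegular.nil, and_true] at hab ⊢
    obtain ⟨hra, hrb⟩ := hab
    have key : ∀ x y : N, b • x = a • y → ∃ z, x = a • z := fun x y hxy => by
      have hx : Submodule.Quotient.mk (p := (a • ⊤ : Submodule A N)) x = 0 := by
        refine hrb.right_eq_zero_of_smul ?_
        rw [← Submodule.Quotient.mk_smul, Submodule.Quotient.mk_eq_zero, hxy]
        exact Submodule.smul_mem_pointwise_smul _ _ _ trivial
      obtain ⟨z, -, hz⟩ := (Submodule.mem_smul_pointwise_iff_exists _ _ _).mp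
        ((Submodule.Quotient.mk_eq_zero _).mp hx)
      exact ⟨z, hz.symm⟩
    constructor
    · have : Subsingleton (Submodule.torsionBy A N b) :=
        (ha.torsionBy b).subsingleton fun ⟨x, hx⟩ => by
          obtain ⟨z, rfl⟩ := key x 0 (by simpa using hx)
          refine ⟨⟨z, ?_⟩, rfl⟩
          rw [Submodule.mem_torsionBy_iff] at hx ⊢
          rw [smul_comm] at hx
          exact hra.right_eq_zero_of_smul hx
      refine isSMulRegular_iff_right_eq_zero_of_smul.mpr fun x hx => ?_
      exact congrArg Subtype.val (Subsingleton.elim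
        (⟨x, hx⟩ : Submodule.torsionBy A N b) 0)
    · refine isSMulRegular_iff_right_eq_zero_of_smul.mpr fun x hx => ?_
      obtain ⟨x, rfl⟩ := Submodule.mkQ_surjective _ x
      rw [← map_smul, Submodule.mkQ_apply, Submodule.Quotient.mk_eq_zero,
        Submodule.mem_smul_pointwise_iff_exists] at hx
      obtain ⟨y, -, hy⟩ := hx
      obtain ⟨z, rfl⟩ := key y x hy
      rw [smul_comm] at hy
      rw [← hra hy, Submodule.mkQ_apply, Submodule.Quotient.mk_eq_zero]
      exact Submodule.smul_mem_pointwise_smul _ _ _ trivial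
  · have : Ideal.ofList [b, a] = Ideal.ofList [a, b] := by simp [sup_comm]
    rw [this]
    exact h'.2

/-- An element of a weakly regular sequence can be moved to the front past elements with respect
to which the module is derived complete. -/
lemma RingTheory.Sequence.IsWeaklyRegular.move_to_front {a : A} {l l' : List A}
    (hl : ∀ c ∈ l, IsDerivedComplete c N) (h : IsWeaklyRegular N (l ++ a :: l')) :
    IsWeaklyRegular N (a :: (l ++ l')) := by
  induction l generalizing N with
  | nil => exact h
  | cons c l ih =>
    rw [List.cons_append, isWeaklyRegular_cons_iff] at h
    exact swap_of_isDerivedComplete (hl c List.mem_cons_self) <| .cons h.1 <|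
      ih (fun d hd => (hl d (List.mem_cons_of_mem _ hd)).quotSMulTop c) h.2

/-- A linear map inducing an isomorphism modulo `a` preserves and reflects weakly regular sequences
starting with `a`, provided that `a` is regular on both sides. -/
lemma isWeaklyRegular_cons_congr {a : A} {l : List A} (f : N →ₗ[A] P)
    (hsurj : ∀ y, ∃ x z, y = f x + a • z) (hinj : ∀ x z, f x = a • z → ∃ x', x = a • x')
    (hN : IsSMulRegular N a) (hP : IsSMulRegular P a) :
    IsWeaklyRegular N (a :: l) ↔ IsWeaklyRegular P (a :: l) := by
  rw [isWeaklyRegular_cons_iff, isWeaklyRegular_cons_iff, and_iff_right hN, and_iff_right hP]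
  refine (LinearEquiv.ofBijective (QuotSMulTop.map a f) ⟨?_, ?_⟩).isWeaklyRegular_congr l
  · refine (injective_iff_map_eq_zero _).mpr fun x hx => ?_
    obtain ⟨x, rfl⟩ := Submodule.mkQ_surjective _ x
    rw [Submodule.mkQ_apply, QuotSMulTop.map_apply_mk, Submodule.Quotient.mk_eq_zero,
      Submodule.mem_smul_pointwise_iff_exists] at hx
    obtain ⟨z, -, hz⟩ := hx
    obtain ⟨x', rfl⟩ := hinj x z hz.symm
    rw [Submodule.mkQ_apply, Submodule.Quotient.mk_eq_zero]
    exact Submodule.smul_mem_pointwise_smul _ _ _ trivial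
  · intro y
    obtain ⟨y, rfl⟩ := Submodule.mkQ_surjective _ y
    obtain ⟨x, z, rfl⟩ := hsurj y
    refine ⟨Submodule.Quotient.mk x, ?_⟩
    rw [QuotSMulTop.map_apply_mk, Submodule.mkQ_apply, Submodule.Quotient.eq]
    rw [sub_add_cancel_left, ← smul_neg]
    exact Submodule.smul_mem_pointwise_smul _ _ _ trivial

end DerivedComplete

section Completion

open PowerSeries

variable {R : Type*} [CommRing R] (C : Type*) [CommRing C] [Algebra R C] (r : R)

/-- The derived completion of the ring `C` with respect to `r`, when `r` is regular on `C`. -/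
abbrev PowerSeriesCompletion : Type _ :=
  PowerSeries C ⧸ Ideal.span {(X - algebraMap R (PowerSeries C) r : PowerSeries C)}

namespace PowerSeriesCompletion

variable {C r}

lemma mk_eq_zero_iff {f : PowerSeries C} :
    (Ideal.Quotient.mk _ f : PowerSeriesCompletion C r) = 0 ↔
      ∃ g, (X - algebraMap R (PowerSeries C) r) * g = f := by
  rw [Ideal.Quotient.eq_zero_iff_mem, Ideal.mem_span_singleton, dvd_def]
  simp only [eq_comm]

lemma isDerivedComplete {a : R} (h : IsDerivedComplete a C) :
    IsDerivedComplete a (PowerSeriesCompletion C r) := by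
  have h' : IsDerivedComplete a (PowerSeries C) :=
    h.pi (ι := Unit →₀ ℕ)
  exact h'.of_surjective h'
    (LinearMap.mulLeft R (X - algebraMap R (PowerSeries C) r : PowerSeries C))
    (Ideal.Quotient.mkₐ R _).toLinearMap Ideal.Quotient.mk_surjective fun f => mk_eq_zero_iff

lemma isDerivedComplete_X :
    IsDerivedComplete (X : PowerSeries C) (PowerSeries C) := by
  refine .mk' (fun b hb n => ?_) fun c => ?_
  · ext m
    induction m generalizing n with
    | zero => simp [hb n]
    | succ m ih => rw [hb n, smul_eq_mul, coeff_succ_X_mul, ih, map_zero, map_zero]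
  · refine ⟨fun n => PowerSeries.mk fun m =>
      ∑ k ∈ Finset.range (m + 1), coeff (m - k) (c (n + k)), fun n => ?_⟩
    ext m
    cases m with
    | zero => simp
    | succ m =>
      rw [smul_eq_mul, map_sub, coeff_succ_X_mul, coeff_mk, coeff_mk,
        Finset.sum_range_succ']
      simp [add_assoc, add_comm 1]

lemma isDerivedComplete_self : IsDerivedComplete r (PowerSeriesCompletion C r) := by
  have h : IsDerivedComplete (X : PowerSeries C) (PowerSeriesCompletion C r) :=
    isDerivedComplete_X.of_surjective isDerivedComplete_X
      (LinearMap.mulLeft _ (X - algebraMap R (PowerSeries C) r)) (Submodule.mkQ _)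
      (Submodule.mkQ_surjective _) fun f => mk_eq_zero_iff
  have hX : ∀ y : PowerSeriesCompletion C r, (X : PowerSeries C) • y = r • y := fun y => by
    rw [← sub_eq_zero]
    obtain ⟨f, rfl⟩ := Ideal.Quotient.mk_surjective y
    exact mk_eq_zero_iff.mpr ⟨f, by rw [sub_mul, ← Algebra.smul_def]; rfl⟩
  unfold IsDerivedComplete at h ⊢
  simpa only [hX] using h

lemma isSMulRegular (h : IsSMulRegular C r) :
    IsSMulRegular (PowerSeriesCompletion C r) r := by
  refine isSMulRegular_iff_right_eq_zero_of_smul.mpr fun y hy => ?_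
  obtain ⟨f, rfl⟩ := Ideal.Quotient.mk_surjective y
  have hreg : IsSMulRegular (PowerSeries C) r := fun f g hfg => by
    ext n
    exact h (by simpa using congrArg (coeff n) hfg)
  obtain ⟨g, hg⟩ := mk_eq_zero_iff.mp (show Ideal.Quotient.mk _ (r • f) = 0 from hy)
  rw [sub_mul, ← Algebra.smul_def, sub_eq_iff_eq_add, ← smul_add] at hg
  have hfg : constantCoeff (f + g) = 0 := by
    refine h.right_eq_zero_of_smul ?_
    rw [← constantCoeff_smul, ← hg]
    simp
  obtain ⟨q, hq⟩ := X_dvd_iff.mpr hfg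
  have hgq : g = r • q := X_mul_cancel (by rw [hg, hq, mul_smul_comm])
  refine mk_eq_zero_iff.mpr ⟨q, ?_⟩
  rw [sub_mul, ← Algebra.smul_def, ← hgq, ← hq, add_sub_cancel_right]

variable (C r) in
/-- The canonical map from a ring to its completion. -/
noncomputable def of : C →ₐ[R] PowerSeriesCompletion C r :=
  (Ideal.Quotient.mkₐ R _).comp ((Algebra.ofId C (PowerSeries C)).restrictScalars R)

lemma isWeaklyRegular_iff {l : List R} (h : IsSMulRegular C r) :
    IsWeaklyRegular C (r :: l) ↔ IsWeaklyRegular (PowerSeriesCompletion C r) (r :: l) := by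
  refine isWeaklyRegular_cons_congr (of C r).toLinearMap (fun y => ?_) (fun x z hxz => ?_) h
    (isSMulRegular h)
  · obtain ⟨f, rfl⟩ := Ideal.Quotient.mk_surjective y
    refine ⟨constantCoeff f, Ideal.Quotient.mk _ (mk fun p => coeff (p + 1) f), ?_⟩
    refine sub_eq_zero.mp (show Ideal.Quotient.mk _ (f - (algebraMap C (PowerSeries C)
      (constantCoeff f) + r • mk fun p => coeff (p + 1) f)) = 0 from mk_eq_zero_iff.mpr
        ⟨mk fun p => coeff (p + 1) f, ?_⟩)
    conv_rhs => enter [1]; rw [eq_X_mul_shift_add_const f]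
    rw [sub_mul, ← Algebra.smul_def, PowerSeries.algebraMap_apply, Algebra.algebraMap_self_apply]
    ring
  · obtain ⟨f, rfl⟩ := Ideal.Quotient.mk_surjective z
    rw [← sub_eq_zero] at hxz
    obtain ⟨g, hg⟩ := mk_eq_zero_iff.mp
      (show Ideal.Quotient.mk _ (algebraMap C (PowerSeries C) x - r • f) = 0 from hxz)
    refine ⟨constantCoeff f - constantCoeff g, ?_⟩
    have := congrArg constantCoeff hg
    rw [sub_mul, ← Algebra.smul_def, map_sub, map_sub, map_mul, constantCoeff_X, zero_mul,
      zero_sub, constantCoeff_smul, constantCoeff_smul, PowerSeries.algebraMap_apply, constantCoeff_C,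
      Algebra.algebraMap_self_apply] at this
    rw [smul_sub, sub_eq_add_neg, this]
    abel

/-- Setting the variable to zero defines a map from the completion to any quotient of `C` in which
`r` vanishes. -/
noncomputable def toQuotient (I : Ideal C) (hr : algebraMap R C r ∈ I) :
    PowerSeriesCompletion C r →ₐ[R] C ⧸ I :=
  Ideal.Quotient.liftₐ _ ((Ideal.Quotient.mkₐ R I).comp (AlgHom.mk constantCoeff (fun s => by
    simp [PowerSeries.algebraMap_apply]))) fun f hf => by
      obtain ⟨g, rfl⟩ := Ideal.mem_span_singleton.mp hf
      simp [PowerSeries.algebraMap_apply, Ideal.Quotient.eq_zero_iff_mem.mpr hr]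

end PowerSeriesCompletion

lemma Ideal.map_algebraMap_ne_top_of_algHom {R C D : Type*} [CommRing R] [CommRing C]
    [Algebra R C] [CommRing D] [Algebra R D] (f : D →ₐ[R] C) {I : Ideal R}
    (hI : I.map (algebraMap R C) ≠ ⊤) : I.map (algebraMap R D) ≠ ⊤ := fun h => hI <| by
  rw [← f.comp_algebraMap, ← Ideal.map_map, h, Ideal.map_top]

lemma PowerSeriesCompletion.map_ne_top {C : Type*} [CommRing C] [Algebra R C] {r : R}
    {I : Ideal R} (hr : r ∈ I) (hI : I.map (algebraMap R C) ≠ ⊤) :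
    I.map (algebraMap R (PowerSeriesCompletion C r)) ≠ ⊤ := by
  refine Ideal.map_algebraMap_ne_top_of_algHom
    (toQuotient (I.map (algebraMap R C)) (Ideal.mem_map_of_mem _ hr)) fun h => hI ?_
  rw [IsScalarTower.algebraMap_eq R C (C ⧸ _), ← Ideal.map_map, Ideal.Quotient.algebraMap_eq,
    Ideal.map_quotient_self] at h
  exact Ideal.Quotient.subsingleton_iff.mp
    ((Submodule.subsingleton_iff (C ⧸ _)).mp (subsingleton_of_bot_eq_top h))

/-- A weakly regular sequence on an algebra stays weakly regular, up to order, on some algebra which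
is derived complete with respect to its entries. -/
lemma exists_isDerivedComplete {R : Type*} [CommRing R] {I : Ideal R} (l₂ : List R)
    (B : Type w) [CommRing B] [Algebra R B] (hB : I.map (algebraMap R B) ≠ ⊤)
    (l₁ : List R) (h₁ : ∀ a ∈ l₁, IsDerivedComplete a B) (h₂ : ∀ a ∈ l₂, a ∈ I)
    (h : IsWeaklyRegular B (l₁ ++ l₂)) :
    ∃ (C : Type w) (_ : CommRing C) (_ : Algebra R C) (l : List R), l.Perm (l₁ ++ l₂) ∧
      IsWeaklyRegular C l ∧ (∀ a ∈ l, IsDerivedComplete a C) ∧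
      I.map (algebraMap R C) ≠ ⊤ ∧ Nonempty (B →ₐ[R] C) := by
  induction l₂ generalizing B l₁ with
  | nil =>
    rw [List.append_nil] at h ⊢
    exact ⟨B, _, _, l₁, .refl _, h, h₁, hB, ⟨.id R B⟩⟩
  | cons a l₂ ih =>
    have ha := h.move_to_front h₁
    have hreg := ((isWeaklyRegular_cons_iff B _ _).mp ha).1
    obtain ⟨C, _, _, l, hl, hlC, hC, hI, ⟨f⟩⟩ := ih (PowerSeriesCompletion B a)
      (PowerSeriesCompletion.map_ne_top (h₂ a List.mem_cons_self) hB) (a :: l₁)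
      (List.forall_mem_cons.mpr ⟨PowerSeriesCompletion.isDerivedComplete_self,
        fun c hc => PowerSeriesCompletion.isDerivedComplete (h₁ c hc)⟩)
      (fun c hc => h₂ c (List.mem_cons_of_mem _ hc))
      ((PowerSeriesCompletion.isWeaklyRegular_iff hreg).mp ha)
    exact ⟨C, _, _, l, hl.trans List.perm_middle.symm, hlC, hC, hI,
      ⟨f.comp (PowerSeriesCompletion.of B a)⟩⟩

end Completion

section SystemOfParameters

variable {R : Type*} [CommRing R] [IsLocalRing R]

lemma Ideal.ofList_congr_perm {R : Type*} [CommRing R] {l l' : List R} (h : l.Perm l') :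
    Ideal.ofList l = Ideal.ofList l' :=
  congrArg Ideal.span (Set.ext fun _ => h.mem_iff)

/-- In a system of parameters, one entry can be replaced by any element avoiding the minimal primes
of the others. -/
lemma radical_ofList_append_eq_maximalIdeal [IsNoetherianRing R] {l : List R} {a z : R}
    (h : (Ideal.ofList (a :: l)).radical = maximalIdeal R) (hz : z ∈ maximalIdeal R)
    (hzl : ∀ p ∈ (Ideal.ofList l).minimalPrimes, z ∉ p) :
    (Ideal.ofList (z :: l)).radical = maximalIdeal R := by
  have hle : Ideal.ofList (a :: l) ≤ maximalIdeal R := h ▸ Ideal.le_radical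
  rw [Ideal.ofList_cons, sup_le_iff] at hle
  refine le_antisymm ?_ ?_
  · refine (maximalIdeal.isMaximal R).isPrime.radical_le_iff.mpr ?_
    rw [Ideal.ofList_cons, sup_le_iff, Ideal.span_singleton_le_iff_mem]
    exact ⟨hz, hle.2⟩
  · rw [Ideal.radical_eq_sInf]
    refine le_sInf fun q ⟨hq, hqp⟩ => ?_
    rw [Ideal.ofList_cons, sup_le_iff, Ideal.span_singleton_le_iff_mem] at hq
    by_contra hmq
    have hlt : q < maximalIdeal R := lt_of_le_not_ge (le_maximalIdeal hqp.ne_top) hmq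
    have hset : {b | b ∈ a :: l} = insert a {b | b ∈ l} := by ext; simp
    refine hzl q (Ideal.mem_minimalPrimes_span_of_mem_minimalPrimes_span_insert hlt a {b | b ∈ l}
      ?_ {b | b ∈ l} (Ideal.span_le.mp hq.2) ?_) hq.1
    · rw [← hset]
      refine ⟨⟨inferInstance, ?_⟩, fun p ⟨hp, hpl⟩ _ => ?_⟩
      · exact h ▸ Ideal.le_radical
      · rw [← h]
        exact hp.radical_le_iff.mpr hpl
    · exact ((Set.subset_insert _ _).trans Ideal.subset_span).trans Ideal.le_radical

lemma exists_mem_maximalIdeal_notMem_minimalPrimes [IsNoetherianRing R] {l l' : List R}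
    (hl : l.length < ringKrullDim R) (hl' : l'.length < ringKrullDim R) :
    ∃ z ∈ maximalIdeal R, (∀ p ∈ (Ideal.ofList l).minimalPrimes, z ∉ p) ∧
      ∀ p ∈ (Ideal.ofList l').minimalPrimes, z ∉ p := by
  classical
  have key : ∀ l : List R, l.length < ringKrullDim R →
      ∀ p ∈ (Ideal.ofList l).minimalPrimes, ¬ maximalIdeal R ≤ p := by
    intro l hl p hp hmp
    have hpm : maximalIdeal R = p :=
      (maximalIdeal.isMaximal R).eq_of_le hp.1.1.ne_top hmp
    rw [← maximalIdeal_height_eq_ringKrullDim, hpm] at hl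
    have hs : {b | b ∈ l} = (l.toFinset : Set R) := by ext; simp
    unfold Ideal.ofList at hp
    rw [hs] at hp
    have := Ideal.height_le_card_of_mem_minimalPrimes_span_finset hp
    refine absurd (this.trans (Nat.cast_le.mpr l.toFinset_card_le)) (not_le.mpr ?_)
    exact_mod_cast hl
  have hfin := (Ideal.finite_minimalPrimes_of_isNoetherianRing R (Ideal.ofList l)).union
    (Ideal.finite_minimalPrimes_of_isNoetherianRing R (Ideal.ofList l'))
  by_contra! hcon
  have hsub : (maximalIdeal R : Set R) ⊆ ⋃ p ∈ (hfin.toFinset : Set (Ideal R)), (p : Set R) := by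
    intro z hz
    simp only [Set.mem_iUnion, Set.Finite.mem_toFinset, SetLike.mem_coe]
    by_cases hzl : ∀ p ∈ (Ideal.ofList l).minimalPrimes, z ∉ p
    · obtain ⟨p, hp, hzp⟩ := hcon z hz hzl
      exact ⟨p, .inr hp, hzp⟩
    · push Not at hzl
      obtain ⟨p, hp, hzp⟩ := hzl
      exact ⟨p, .inl hp, hzp⟩
  obtain ⟨p, hp, hmp⟩ := (Ideal.subset_union_prime (f := id) ⊥ ⊥ fun p hp _ _ => by
    rcases (Set.Finite.mem_toFinset hfin).mp hp with hp | hp <;> exact hp.1.1).mp hsub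
  rcases (Set.Finite.mem_toFinset hfin).mp hp with hp | hp
  exacts [key l hl p hp hmp, key l' hl' p hp hmp]

lemma RingTheory.Sequence.IsWeaklyRegular.replace_last {R M : Type*} [CommRing R]
    [AddCommGroup M] [Module R M] {l : List R} {a b : R} (h : IsWeaklyRegular M (l ++ [a]))
    (ha : a ∈ (Ideal.ofList (b :: l)).radical) : IsWeaklyRegular M (l ++ [b]) := by
  rw [isWeaklyRegular_append_iff, isWeaklyRegular_singleton_iff] at h ⊢
  refine ⟨h.1, isSMulRegular_iff_right_eq_zero_of_smul.mpr fun x hx => ?_⟩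
  obtain ⟨n, hn⟩ := ha
  rw [Ideal.ofList_cons, Submodule.mem_sup] at hn
  obtain ⟨c, hc, d, hd, hcd⟩ := hn
  obtain ⟨c, rfl⟩ := Ideal.mem_span_singleton'.mp hc
  refine (h.2.pow n).right_eq_zero_of_smul ?_
  rw [← hcd, add_smul, mul_smul, hx, smul_zero, zero_add]
  obtain ⟨x, rfl⟩ := Submodule.mkQ_surjective _ x
  rw [← map_smul, Submodule.mkQ_apply, Submodule.Quotient.mk_eq_zero]
  exact Submodule.smul_mem_smul hd trivial

/-- If regular sequences on `M` can be permuted and one system of parameters is regular on `M`, then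
so are all of them. -/
lemma isWeaklyRegular_of_radical_ofList_eq [IsNoetherianRing R] {M : Type*} [AddCommGroup M]
    [Module R M]
    (hperm : ∀ l l' : List R, (∀ r ∈ l, r ∈ maximalIdeal R) → l.Perm l' →
      IsWeaklyRegular M l → IsWeaklyRegular M l')
    (x y w : List R) (hxy : x.length = y.length)
    (hx' : ((w ++ x).length : WithBot ℕ∞) = ringKrullDim R)
    (hx : (Ideal.ofList (w ++ x)).radical = maximalIdeal R)
    (hy : (Ideal.ofList (w ++ y)).radical = maximalIdeal R)
    (h : IsWeaklyRegular M (w ++ x)) : IsWeaklyRegular M (w ++ y) := by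
  have hmem : ∀ {l : List R}, (Ideal.ofList l).radical = maximalIdeal R →
      ∀ r ∈ l, r ∈ maximalIdeal R := fun hl r hr =>
    hl ▸ Ideal.le_radical (Ideal.subset_span hr)
  have hlast : ∀ (l : List R) (r : R), (l ++ [r]).Perm (r :: l) := fun l r =>
    List.perm_append_singleton r l
  induction x generalizing w y with
  | nil =>
    rw [List.length_nil, eq_comm, List.length_eq_zero_iff] at hxy
    rwa [hxy]
  | cons a x ih =>
    obtain _ | ⟨b, y⟩ := y
    · simp at hxy
    have hpx : (w ++ a :: x).Perm (a :: (w ++ x)) := List.perm_middle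
    have hpy : (w ++ b :: y).Perm (b :: (w ++ y)) := List.perm_middle
    rw [Ideal.ofList_congr_perm hpx] at hx
    rw [Ideal.ofList_congr_perm hpy] at hy
    simp only [List.length_cons, add_left_inj] at hxy
    have hdim : ((w ++ x).length : WithBot ℕ∞) < ringKrullDim R := by
      rw [← hx', hpx.length_eq, List.length_cons]
      exact_mod_cast Nat.lt_succ_self _
    obtain ⟨z, hz, hzx, hzy⟩ := exists_mem_maximalIdeal_notMem_minimalPrimes hdim
      (l' := w ++ y) (by rwa [List.length_append, ← hxy, ← List.length_append])
    have hzx := radical_ofList_append_eq_maximalIdeal hx hz hzx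
    have hzy := radical_ofList_append_eq_maximalIdeal hy hz hzy
    have h₁ : IsWeaklyRegular M (z :: (w ++ x)) := by
      refine hperm _ _ ?_ (hlast _ _) ((hperm _ _ ?_ (hpx.trans (hlast _ _).symm) h).replace_last
        (hzx ▸ hmem hx a List.mem_cons_self))
      · exact fun r hr => hmem hzx r ((hlast _ _).mem_iff.mp hr)
      · exact fun r hr => hmem hx r (hpx.mem_iff.mp hr)
    have h₂ : IsWeaklyRegular M (z :: (w ++ y)) := by
      refine ih y (z :: w) hxy ?_ hzx hzy h₁
      rw [← hx', hpx.length_eq]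
      simp
    refine hperm _ _ ?_ ((hlast _ _).trans hpy.symm) ((hperm _ _ (hmem hzy)
      (hlast _ _).symm h₂).replace_last (hy ▸ hz))
    exact fun r hr => hmem hy r ((hlast _ _).mem_iff.mp hr)

end SystemOfParameters

section FractionPullback

variable {R D C : Type*} [CommRing R] [CommRing D] [Algebra R D] [CommRing C] [Algebra R C]
  (φ : D →ₐ[R] C)

/-- The elements of `R` which are nonzerodivisors on `C`. -/
def regularSubmonoid (R C : Type*) [CommRing R] [CommRing C] [Algebra R C] : Submonoid R :=
  (nonZeroDivisors C).comap (algebraMap R C)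

lemma mem_regularSubmonoid_iff {r : R} : r ∈ regularSubmonoid R C ↔ IsSMulRegular C r := by
  rw [regularSubmonoid, Submonoid.mem_comap, mem_nonZeroDivisors_iff_left,
    isSMulRegular_iff_right_eq_zero_of_smul]
  simp only [Algebra.smul_def]

/-- The localization of `D` at the elements of `R` which are nonzerodivisors on `C`. -/
abbrev RegularLocalization (R D C : Type*) [CommRing R] [CommRing D] [Algebra R D] [CommRing C]
    [Algebra R C] : Type _ :=
  Localization (Algebra.algebraMapSubmonoid D (regularSubmonoid R C))

/-- The ring of fractions `f / w`, where `w ∈ R` is a nonzerodivisor on `C` which divides `φ f`. It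
is the pullback of the localization of `D` and `C` over the localization of `C`. -/
def fractionPullback : Subalgebra R (RegularLocalization R D C × C) where
  carrier := {p | ∃ w ∈ regularSubmonoid R C, ∃ f : D,
    w • p.1 = algebraMap D _ f ∧ w • p.2 = φ f}
  mul_mem' := by
    rintro p q ⟨w, hw, f, hf, hf'⟩ ⟨v, hv, g, hg, hg'⟩
    refine ⟨w * v, mul_mem hw hv, f * g, ?_, ?_⟩
    · rw [map_mul, ← hf, ← hg, smul_mul_smul_comm, Prod.fst_mul]
    · rw [map_mul, ← hf', ← hg', smul_mul_smul_comm, Prod.snd_mul]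
  add_mem' := by
    rintro p q ⟨w, hw, f, hf, hf'⟩ ⟨v, hv, g, hg, hg'⟩
    have hs (r : R) (f : D) : algebraMap D (RegularLocalization R D C) (r • f) =
        r • algebraMap D _ f :=
      map_smul (IsScalarTower.toAlgHom R D (RegularLocalization R D C)) r f
    refine ⟨w * v, mul_mem hw hv, v • f + w • g, ?_, ?_⟩
    · rw [map_add, hs, hs, ← hf, ← hg, Prod.fst_add, smul_add,
        mul_smul, mul_smul, smul_comm w v]
    · rw [map_add, map_smul, map_smul, ← hf', ← hg', Prod.snd_add, smul_add,
        mul_smul, mul_smul, smul_comm w v]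
  algebraMap_mem' r := ⟨1, one_mem _, algebraMap R D r, by
    rw [one_smul, ← IsScalarTower.algebraMap_apply, Prod.algebraMap_apply], by
    rw [one_smul, AlgHom.commutes, Prod.algebraMap_apply]⟩

namespace fractionPullback

/-- The canonical map from `D` to the ring of fractions. -/
noncomputable def of : D →ₐ[R] fractionPullback φ :=
  ((IsScalarTower.toAlgHom R D (RegularLocalization R D C)).prod φ).codRestrict _
    fun f => ⟨1, one_mem _, f, one_smul _ _, one_smul _ _⟩

/-- The projection to `C`. -/
def toTarget : fractionPullback φ →ₐ[R] C :=
  (AlgHom.snd R _ C).comp (fractionPullback φ).val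

lemma isUnit_algebraMap {w : R} (hw : w ∈ regularSubmonoid R C) :
    IsUnit (algebraMap R (RegularLocalization R D C) w) := by
  rw [IsScalarTower.algebraMap_apply R D]
  exact IsLocalization.map_units (RegularLocalization R D C)
    (⟨_, Algebra.mem_algebraMapSubmonoid_of_mem ⟨w, hw⟩⟩ :
      Algebra.algebraMapSubmonoid D (regularSubmonoid R C))

variable {φ}

lemma isSMulRegular {w : R} (hw : w ∈ regularSubmonoid R C) :
    IsSMulRegular (fractionPullback φ) w := by
  refine isSMulRegular_iff_right_eq_zero_of_smul.mpr fun ⟨p, hp⟩ h => Subtype.ext ?_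
  have h : w • p = 0 := congrArg Subtype.val h
  refine Prod.ext ?_ ?_
  · have h₁ : w • p.1 = 0 := congrArg Prod.fst h
    rw [Algebra.smul_def] at h₁
    exact (isUnit_algebraMap hw).mul_right_eq_zero.mp h₁
  · exact (mem_regularSubmonoid_iff.mp hw).right_eq_zero_of_smul (congrArg Prod.snd h)

lemma exists_eq_smul_of_toTarget_eq_zero {w : R} (hw : w ∈ regularSubmonoid R C)
    {p : fractionPullback φ} (hp : toTarget φ p = 0) : ∃ q, p = w • q := by
  obtain ⟨⟨p, c⟩, v, hv, f, hf, hf'⟩ := p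
  obtain rfl : c = 0 := hp
  obtain ⟨u, hu⟩ := (isUnit_algebraMap (D := D) hw).exists_right_inv
  have hwu : w • (u * p) = p := by rw [Algebra.smul_def, ← mul_assoc, hu, one_mul]
  refine ⟨⟨(u * p, 0), v * w, mul_mem hv hw, f, ?_, ?_⟩, Subtype.ext (Prod.ext hwu.symm ?_)⟩
  · rw [mul_smul, hwu, hf]
  · rw [← hf', smul_zero, smul_zero]
  · exact (smul_zero w).symm

lemma isWeaklyRegular_iff (hφ : Function.Surjective φ) {r : R} {l : List R}
    (hr : IsSMulRegular C r) :
    IsWeaklyRegular (fractionPullback φ) (r :: l) ↔ IsWeaklyRegular C (r :: l) := by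
  have hr' := mem_regularSubmonoid_iff.mpr hr
  have hsurj : Function.Surjective (toTarget φ) := fun c =>
    let ⟨f, hf⟩ := hφ c
    ⟨of φ f, hf⟩
  refine isWeaklyRegular_cons_congr (toTarget φ).toLinearMap (fun c => ?_) (fun p c h => ?_)
    (isSMulRegular hr') hr
  · obtain ⟨p, hp⟩ := hsurj c
    exact ⟨p, 0, by rw [smul_zero, add_zero]; exact hp.symm⟩
  · obtain ⟨q, rfl⟩ := hsurj c
    obtain ⟨q', hq'⟩ := exists_eq_smul_of_toTarget_eq_zero (p := p - r • q) hr' (by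
      rw [map_sub, map_smul, sub_eq_zero]
      exact h)
    exact ⟨q + q', by rw [smul_add, ← hq', add_sub_cancel]⟩

lemma fst_injective : Function.Injective fun p : fractionPullback φ => p.1.1 := by
  refine (injective_iff_map_eq_zero
    ((RingHom.fst _ _).comp (fractionPullback φ).val.toRingHom)).mpr ?_
  rintro ⟨⟨p, c⟩, v, hv, f, hf, hf'⟩ (rfl : p = 0)
  refine Subtype.ext (Prod.ext rfl ?_)
  rw [smul_zero, eq_comm, IsLocalization.map_eq_zero_iff
    (Algebra.algebraMapSubmonoid D (regularSubmonoid R C))] at hf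
  obtain ⟨⟨_, u, hu, rfl⟩, huf⟩ := hf
  have h : (u * v) • c = 0 := by
    rw [mul_smul, hf', ← map_smul, Algebra.smul_def, huf, map_zero]
  exact (mem_regularSubmonoid_iff.mp (mul_mem hu hv)).right_eq_zero_of_smul h

lemma isReduced [IsReduced D] : IsReduced (fractionPullback φ) :=
  isReduced_of_injective ((RingHom.fst _ _).comp (fractionPullback φ).val.toRingHom) fst_injective

lemma isDomain [IsDomain D] [Nontrivial C] (φ : D →ₐ[R] C) : IsDomain (fractionPullback φ) :=
  have : IsDomain (RegularLocalization R D C) := by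
    refine IsLocalization.isDomain_localization (le_nonZeroDivisors_of_noZeroDivisors ?_)
    rintro ⟨w, hw, hw0⟩
    have : algebraMap R C w = 0 := by
      rw [← φ.commutes w]
      exact (congrArg φ hw0).trans (map_zero φ)
    exact nonZeroDivisors.ne_zero hw this
  Function.Injective.isDomain ((RingHom.fst _ _).comp (fractionPullback φ).val.toRingHom)
    fst_injective

end fractionPullback

end FractionPullback

lemma Ideal.ofList_ofFn {R : Type*} [CommRing R] {n : ℕ} (x : Fin n → R) :
    Ideal.ofList (List.ofFn x) = Ideal.span (Set.range x) :=
  congrArg Ideal.span (Set.ext fun _ => List.mem_ofFn' ..)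

/-- An algebra homomorphism `S → C` extends to a surjective one from a polynomial ring over `S`. -/
lemma exists_surjective_mvPolynomial {R S C : Type*} [CommRing R] [CommRing S] [Algebra R S]
    [CommRing C] [Algebra R C] (g : S →ₐ[R] C) :
    ∃ φ : MvPolynomial C S →ₐ[R] C, Function.Surjective φ :=
  ⟨{ MvPolynomial.eval₂Hom g.toRingHom id with
      commutes' := fun r => by
        simp [MvPolynomial.algebraMap_eq, IsScalarTower.algebraMap_apply R S (MvPolynomial C S)] },
    fun c => ⟨MvPolynomial.X c, MvPolynomial.eval₂Hom_X' g.toRingHom id c⟩⟩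

section BigCohenMacaulay

variable {R : Type*} [CommRing R] [IsLocalRing R]

lemma isRegSeq_of_isWeaklyRegular {B : Type*} [CommRing B] [Algebra R B]
    (hB : (maximalIdeal R).map (algebraMap R B) ≠ ⊤) {n : ℕ} {x : Fin n → R}
    (hx : ∀ i, x i ∈ maximalIdeal R) (h : IsWeaklyRegular B (List.ofFn x)) :
    IsRegSeq R B x := by
  refine ⟨h, fun htop => hB ((Ideal.eq_top_iff_one _).mpr ?_)⟩
  have h1 : (1 : B) ∈ Ideal.ofList (List.ofFn x) • (⊤ : Submodule R B) := htop ▸ trivial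
  rw [Ideal.smul_top_eq_map, Ideal.ofList_ofFn] at h1
  exact Ideal.map_mono (Ideal.span_le.mpr (Set.range_subset_iff.mpr hx)) h1

/-- Every big Cohen-Macaulay algebra maps to a balanced one. -/
lemma IsBigCM.exists_isBalancedBigCM [IsNoetherianRing R] {B : Type w} [CommRing B]
    [Algebra R B] (hB : IsBigCM R B) :
    ∃ (C : Type w) (_ : CommRing C) (_ : Algebra R C),
      IsBalancedBigCM R C ∧ Nonempty (B →ₐ[R] C) := by
  obtain ⟨⟨n, x, ⟨hn, hxm, hx⟩, hreg⟩, hm⟩ := hB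
  obtain ⟨C, _, _, l, hl, hlC, hcomp, hmC, hBC⟩ := exists_isDerivedComplete (List.ofFn x) B hm []
    (by simp) (fun a ha => by
      obtain ⟨i, rfl⟩ := List.mem_ofFn.mp ha
      exact hxm i) hreg.toIsWeaklyRegular
  rw [List.nil_append] at hl
  have hlr : (Ideal.ofList l).radical = maximalIdeal R := by
    rw [Ideal.ofList_congr_perm hl, Ideal.ofList_ofFn, hx]
  refine ⟨C, _, _, ⟨fun k y ⟨hk, hym, hy⟩ => isRegSeq_of_isWeaklyRegular hmC hym ?_, hmC⟩, hBC⟩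
  refine isWeaklyRegular_of_radical_ofList_eq
    (fun r r' hr hp h => h.perm_of_isDerivedComplete hcomp ?_ hp) l (List.ofFn y) [] ?_ ?_ hlr ?_ hlC
  · exact hlr ▸ hr
  · rw [hl.length_eq, List.length_ofFn, List.length_ofFn]
    exact_mod_cast hn.trans hk.symm
  · rw [List.nil_append, hl.length_eq, List.length_ofFn, hn]
  · rw [List.nil_append, Ideal.ofList_ofFn, hy]

lemma fractionPullback.isBalancedBigCM {D C : Type*} [CommRing D] [Algebra R D] [CommRing C]
    [Algebra R C] {φ : D →ₐ[R] C} (hφ : Function.Surjective φ) (hC : IsBalancedBigCM R C) :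
    IsBalancedBigCM R (fractionPullback φ) := by
  have hm := Ideal.map_algebraMap_ne_top_of_algHom (toTarget φ) hC.2
  refine ⟨fun n x hx => isRegSeq_of_isWeaklyRegular hm hx.2.1 ?_, hm⟩
  have h := (hC.1 n x hx).toIsWeaklyRegular
  cases hl : List.ofFn x with
  | nil => exact .nil _ _
  | cons r l =>
    rw [hl] at h
    exact (isWeaklyRegular_iff hφ ((isWeaklyRegular_cons_iff _ _ _).mp h).1).mpr h

end BigCohenMacaulay

/-- **Proposition (Dietz, Prop. 7.5 / `domredmod`).** Let `(R,m)` be a Noetherian local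
ring and let `S` be a seed over `R`. If `S` is a domain (resp. reduced), then `S` maps to
a balanced big Cohen-Macaulay `R`-algebra that is a domain (resp. reduced). -/
theorem domain_reduced_seed_maps_to_domain_reduced_bigCM
    (R : Type u) [CommRing R] [IsLocalRing R] [IsNoetherianRing R]
    (S : Type v) [CommRing S] [Algebra R S] (hS : IsSeed R S) :
    (IsDomain S →
      ∃ (B : Type (max u v)) (_ : CommRing B) (_ : Algebra R B),
        IsBalancedBigCM R B ∧ IsDomain B ∧ Nonempty (S →ₐ[R] B)) ∧
    (IsReduced S →
      ∃ (B : Type (max u v)) (_ : CommRing B) (_ : Algebra R B),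
        IsBalancedBigCM R B ∧ IsReduced B ∧ Nonempty (S →ₐ[R] B)) := by
  obtain ⟨B, _, _, hB, ⟨f⟩⟩ := hS
  obtain ⟨C, _, _, hC, ⟨g⟩⟩ := hB.exists_isBalancedBigCM
  obtain ⟨φ, hφ⟩ := exists_surjective_mvPolynomial (g.comp f)
  have hφC := fractionPullback.isBalancedBigCM hφ hC
  have i : S →ₐ[R] fractionPullback φ :=
    (fractionPullback.of φ).comp (IsScalarTower.toAlgHom R S (MvPolynomial C S))
  refine ⟨fun hS => ⟨fractionPullback φ, _, _, hφC, ?_, ⟨i⟩⟩,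
    fun hS => ⟨fractionPullback φ, _, _, hφC, fractionPullback.isReduced, ⟨i⟩⟩⟩
  have : Nontrivial C := not_subsingleton_iff_nontrivial.mp fun _ => hC.2 (Subsingleton.elim _ _)
  exact fractionPullback.isDomain φ
end
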